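/- Let (a,b) be a perplex parameter and let f = (u,v) : ℝ^{2n} → ℝ² be real analytic with f(0) = 0, and suppose that for each i = 1, …, n the generalized Cauchy–Riemann equation (0,1) * (u_{x_{i1}}, v_{x_{i1}}) = (1,0) * (u_{x_{i2}}, v_{x_{i2}}) holds at every point, where (x_{11}, x_{12}, …, x_{n1}, x_{n2}) are the coordinates of ℝ^{2n} grouped in pairs. Define the i-th perplex partial derivative ∂f/∂p_i(p) := (1,0)⁻¹ * (u_{x_{i1}}(p), v_{x_{i1}}(p)). Then there exist a neighborhood U of 0 in ℝ^{2n}, a constant C > 0, and θ ∈ (0,1) such that for all p ∈ U: max_{1 ≤ i ≤ n} ‖∂f/∂p_i(p)‖_m ≥ C · ‖f(p)‖_m^θ, where ‖y‖_m := max{|y₁|,|y₂|} for y ∈ ℝ². -/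

import Mathlib

open Filter Topology

noncomputable section

/-- The perplex product on `ℝ²` determined by the parameters `a = (a₁,a₂,a₃)`,
`b = (b₁,b₂,b₃)`. -/
def pmul (a₁ a₂ a₃ b₁ b₂ b₃ : ℝ) (x y : ℝ × ℝ) : ℝ × ℝ :=
  (a₁ * x.1 * y.1 + a₂ * (x.1 * y.2 + x.2 * y.1) + a₃ * x.2 * y.2,
   b₁ * x.1 * y.1 + b₂ * (x.1 * y.2 + x.2 * y.1) + b₃ * x.2 * y.2)

/-- `(a,b)` is a perplex parameter: conditions (i)-(iv). -/
def IsPerplexParam (a₁ a₂ a₃ b₁ b₂ b₃ : ℝ) : Prop :=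
  a₁ * a₃ - a₂ ^ 2 ≠ 0 ∧ a₁ * b₂ - a₂ * b₁ ≠ 0 ∧
    a₂ * b₂ - a₃ * b₁ = 0 ∧ a₁ * a₃ - a₂ ^ 2 + a₂ * b₃ - a₃ * b₂ = 0

/-- The multiplicative identity `𝟙` of the perplex algebra. -/
def pone (a₁ a₂ b₁ b₂ : ℝ) : ℝ × ℝ :=
  (1 / (a₁ * b₂ - a₂ * b₁)) • ((b₂, -b₁) : ℝ × ℝ)

open Classical in
/-- The `*`-inverse of `x` (junk value `0` if `x` is not invertible). -/
noncomputable def pinv (a₁ a₂ a₃ b₁ b₂ b₃ : ℝ) (x : ℝ × ℝ) : ℝ × ℝ :=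
  if h : ∃ y, pmul a₁ a₂ a₃ b₁ b₂ b₃ x y = pone a₁ a₂ b₁ b₂ then h.choose else 0

/-- The sup norm `‖·‖ₘ` on `ℝ²`. -/
def mnorm (x : ℝ × ℝ) : ℝ := max |x.1| |x.2|

section
open Polynomial in
theorem lp_coeff_shift {R : Type*} [CommRing R] (p : R[X]) (d : ℕ) (hm : p.Monic)
    (hd : p.natDegree = d + 1) (r : R) :
    (p.comp (X + C r)).coeff d = p.coeff d + (d + 1) * r := by
  have h1 : p.comp (X + C r) = taylor r p := rfl
  rw [h1, taylor_coeff]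
  have hdeg : (hasseDeriv d p).natDegree ≤ 1 := by
    rw [natDegree_le_iff_coeff_eq_zero]
    intro N hN
    rw [hasseDeriv_coeff, coeff_eq_zero_of_natDegree_lt (by omega), mul_zero]
  rw [eval_eq_sum_range' (n := 2) (by omega)]
  have : p.coeff (1 + d) = 1 := by
    rw [add_comm, ← hd]; exact hm
  simp [Finset.sum_range_succ, hasseDeriv_coeff, this]
  rw [add_comm 1 d, Nat.choose_succ_self_right]; push_cast; ring

theorem lp_alg_mem {K : Type*} [NormedField K] [IsUltrametricDist K] [CompleteSpace K]
    (hnat : ∀ n : ℕ, n ≠ 0 → ‖(n : K)‖ = 1)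
    (L : Subfield K) (hcl : IsClosed (L : Set K)) (hnt : ∃ x ∈ L, 1 < ‖x‖)
    (himm : ∀ w : K, w ≠ 0 → ∃ c ∈ L, ‖w - c‖ < ‖w‖)
    (z : K) (hz : IsAlgebraic L z) : z ∈ L := by
  let : NontriviallyNormedField L :=
    { (inferInstance : NormedField L) with
      non_trivial := by
        obtain ⟨x, hx, h1⟩ := hnt
        exact ⟨⟨x, hx⟩, h1⟩ }
  have : CompleteSpace L := hcl.completeSpace_coe
  have : IsUltrametricDist L := ⟨fun x y z => IsUltrametricDist.dist_triangle_max (x : K) y z⟩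
  let A := algebraicClosure L K
  have : Algebra.IsAlgebraic L A := algebraicClosure.isAlgebraic L K
  let f : AbsoluteValue A ℝ :=
    { toFun := fun x => ‖(x : K)‖
      map_mul' := fun x y => by simp
      nonneg' := fun x => norm_nonneg _
      eq_zero' := fun x => by simp
      add_le' := fun x y => norm_add_le _ _ }
  have key : ∀ w : A, ∀ d : ℕ, (minpoly L w).natDegree = d + 1 →
      ‖(minpoly L w).coeff d‖ ≤ ‖(w : K)‖ := by
    intro w d hd
    have h1 : f w = spectralNorm L A w := by
      apply spectralNorm_unique_field_norm_ext
      intro x; rfl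
    change _ ≤ f w
    rw [h1, spectralNorm, spectralValue]
    refine le_trans ?_ (le_ciSup (spectralValueTerms_bddAbove _) d)
    rw [spectralValueTerms_of_lt_natDegree _ (by omega), hd]
    simp
  let zz : A := ⟨z, mem_algebraicClosure_iff.mpr hz⟩
  have hint : IsIntegral L zz := (Algebra.IsAlgebraic.isAlgebraic zz).isIntegral
  obtain ⟨d, hd⟩ : ∃ d, (minpoly L zz).natDegree = d + 1 :=
    ⟨_, (Nat.succ_pred_eq_of_pos (minpoly.natDegree_pos hint)).symm⟩
  have hnz : ((d + 1 : ℕ) : K) ≠ 0 := by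
    intro h; have := hnat (d+1) (by omega); rw [h] at this; simp at this
  have hnz' : ((d : L) + 1) ≠ 0 := by
    intro h; apply hnz; have := congrArg (Subtype.val) h; push_cast at this ⊢; simpa using this
  set a : L := - (minpoly L zz).coeff d / ((d : L) + 1) with ha
  by_contra hzL
  have hne : z - a ≠ 0 := by
    intro h; apply hzL; rw [sub_eq_zero.mp h]; exact a.2
  obtain ⟨c, hc, hlt⟩ := himm _ hne
  have h2 := key (zz - algebraMap L A (a + ⟨c, hc⟩)) d (by
    rw [minpoly.sub_algebraMap, Polynomial.natDegree_comp, hd, Polynomial.natDegree_X_add_C, mul_one])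
  rw [minpoly.sub_algebraMap, lp_coeff_shift _ d (minpoly.monic hint) hd] at h2
  have h3 : (minpoly L zz).coeff d + (d + 1) * (a + ⟨c, hc⟩) = (d + 1) * ⟨c, hc⟩ := by
    rw [ha]; field_simp; ring
  rw [h3, norm_mul] at h2
  have h4 : ‖((d : L) + 1)‖ = 1 := by
    have := hnat (d+1) (by omega)
    push_cast at this
    exact this
  rw [h4, one_mul] at h2
  have h5 : ((zz - algebraMap L A (a + ⟨c, hc⟩) : A) : K) = z - a - c := by
    change z - ((a : K) + c) = _; ring
  rw [h5] at h2
  have h2' : ‖c‖ ≤ ‖z - a - c‖ := h2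
  have h6 : ‖z - a‖ ≤ max ‖z - a - c‖ ‖c‖ := by
    have := IsUltrametricDist.norm_add_le_max (z - a - c) c
    simpa using this
  rw [max_eq_left h2'] at h6
  linarith
end

section
open Polynomial

theorem lp_eval_norm_le {K : Type*} [NormedField K] [IsUltrametricDist K] (k : Subring K)
    (hk : ∀ z ∈ k, z ≠ 0 → ‖z‖ = 1) (z : K) (hz : ‖z‖ ≤ 1) (g : k[X]) :
    ‖eval₂ k.subtype z g‖ ≤ 1 := by
  induction g using Polynomial.induction_on' with
  | add p q hp hq =>
    rw [eval₂_add]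
    exact (IsUltrametricDist.norm_add_le_max _ _).trans (max_le hp hq)
  | monomial n a =>
    rw [eval₂_monomial, norm_mul, norm_pow]
    have h1 : ‖k.subtype a‖ ≤ 1 := by
      by_cases h : (a : K) = 0
      · simp [h]
      · exact (hk a a.2 h).le
    exact mul_le_one₀ h1 (by positivity) (pow_le_one₀ (norm_nonneg _) hz)

theorem lp_alg_norm_ge {K : Type*} [NormedField K] [IsUltrametricDist K] (k : Subring K)
    (hk : ∀ z ∈ k, z ≠ 0 → ‖z‖ = 1) (w : K) (hw : w ≠ 0) (ha : IsAlgebraic k w) : 1 ≤ ‖w‖ := by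
  by_contra hlt
  push Not at hlt
  obtain ⟨q, hq0, hq⟩ := ha.exists_nonzero_coeff_and_aeval_eq_zero (mem_nonZeroDivisors_of_ne_zero hw)
  have h1 : aeval w q = w * eval₂ k.subtype w q.divX + (q.coeff 0 : K) := by
    conv_lhs => rw [← divX_mul_X_add q]
    rw [map_add, map_mul, aeval_X, aeval_C, mul_comm]; rfl
  rw [hq] at h1
  have h2 : (q.coeff 0 : K) = - (w * eval₂ k.subtype w q.divX) := by linear_combination -h1
  have h3 := hk (q.coeff 0) (q.coeff 0).2 (by simpa using hq0)
  rw [h2, norm_neg, norm_mul] at h3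
  have h4 := lp_eval_norm_le k hk w hlt.le q.divX
  nlinarith [norm_nonneg w, norm_nonneg (eval₂ k.subtype w q.divX)]

theorem lp_alg_norm {K : Type*} [NormedField K] [IsUltrametricDist K] (k : Subring K)
    (hk : ∀ z ∈ k, z ≠ 0 → ‖z‖ = 1) (w : K) (hw : w ≠ 0) (ha : IsAlgebraic k w) : ‖w‖ = 1 := by
  refine le_antisymm ?_ (lp_alg_norm_ge k hk w hw ha)
  have := lp_alg_norm_ge k hk w⁻¹ (inv_ne_zero hw) ha.inv
  rw [norm_inv] at this
  exact (one_le_inv₀ (norm_pos_iff.mpr hw)).mp this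

theorem lp_coeff_field {K : Type*} [NormedField K] [IsUltrametricDist K] [IsAlgClosed K]
    (k0 : Subring K) (hk0 : ∀ z ∈ k0, z ≠ 0 → ‖z‖ = 1) :
    ∃ k : Subring K, k0 ≤ k ∧ (∀ z ∈ k, z ≠ 0 → ‖z‖ = 1) ∧
      ∀ z : K, ‖z‖ ≤ 1 → ∃ c ∈ k, ‖z - c‖ < 1 := by
  obtain ⟨k, hle, hmax⟩ := zorn_le_nonempty₀ {k : Subring K | ∀ z ∈ k, z ≠ 0 → ‖z‖ = 1} (by
    intro c hc hch y hy
    refine ⟨sSup c, ?_, fun z hz => le_sSup hz⟩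
    intro z hz hz0
    rw [Subring.mem_sSup_of_directedOn ⟨y, hy⟩ hch.directedOn] at hz
    obtain ⟨s, hs, hzs⟩ := hz
    exact hc hs z hzs hz0) k0 hk0
  have hk : ∀ z ∈ k, z ≠ 0 → ‖z‖ = 1 := hmax.prop
  refine ⟨k, hle, hk, ?_⟩
  -- extension principle
  have hext : ∀ y : K, (∀ g : k[X], eval₂ k.subtype y g ≠ 0 → ‖eval₂ k.subtype y g‖ = 1) →
      y ∈ k := by
    intro y hy
    have h1 : (eval₂RingHom k.subtype y).range ≤ k := by
      apply hmax.le_of_ge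
      · rintro z ⟨g, rfl⟩ hz
        exact hy g hz
      · intro a ha
        exact ⟨C ⟨a, ha⟩, by simp⟩
    exact h1 ⟨X, by simp⟩
  intro z hz
  by_cases hA : ∀ g : k[X], eval₂ k.subtype z g ≠ 0 → ‖eval₂ k.subtype z g‖ = 1
  · exact ⟨z, hext z hA, by simp⟩
  push Not at hA
  obtain ⟨g, hg0, hg1⟩ := hA
  have hlt : ‖eval₂ k.subtype z g‖ < 1 := lt_of_le_of_ne (lp_eval_norm_le k hk z hz g) hg1
  have hgne : g ≠ 0 := by rintro rfl; simp at hg0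
  have hinj : Function.Injective k.subtype := Subtype.val_injective
  have hsplit := IsAlgClosed.splits (g.map k.subtype)
  have hprod := hsplit.eq_prod_roots
  have hroot : ∃ c ∈ (g.map k.subtype).roots, ‖z - c‖ < 1 := by
    by_contra hno
    push Not at hno
    have h1 : eval z (g.map k.subtype) = eval₂ k.subtype z g := eval_map _ _
    rw [hprod] at h1
    rw [eval_mul, eval_C, eval_multiset_prod, Multiset.map_map] at h1
    have hlead : ‖(g.map k.subtype).leadingCoeff‖ = 1 := by
      rw [leadingCoeff_map_of_injective hinj]
      refine hk _ (Subtype.mem _) ?_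
      simpa using hgne
    rw [← h1, norm_mul, hlead, one_mul] at hlt
    have h2 : ∀ s : Multiset K, (∀ c ∈ s, 1 ≤ ‖z - c‖) →
        1 ≤ ‖(s.map (eval z ∘ fun a => X - C a)).prod‖ := by
      intro s
      induction s using Multiset.induction_on with
      | empty => simp
      | cons a s ih =>
        intro h
        rw [Multiset.map_cons, Multiset.prod_cons, norm_mul]
        have e1 := h a (Multiset.mem_cons_self _ _)
        have e2 := ih (fun c hc => h c (Multiset.mem_cons_of_mem hc))
        simp only [Function.comp_apply, eval_sub, eval_X, eval_C] at *
        exact one_le_mul_of_one_le_of_one_le e1 e2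
    have := h2 _ hno
    linarith
  obtain ⟨c, hc, hzc⟩ := hroot
  refine ⟨c, hext c ?_, hzc⟩
  have hcalg : IsAlgebraic k c := ⟨g, hgne, by
    have := (mem_roots'.mp hc).2
    rwa [IsRoot.def, eval_map] at this⟩
  intro h hne
  apply lp_alg_norm k hk _ hne
  have : eval₂ k.subtype c h = aeval c h := rfl
  rw [this]
  have h1 : aeval c h ∈ Algebra.adjoin k {c} := aeval_mem_adjoin_singleton _ _
  have h2 : Algebra.adjoin k {c} ≤ Subalgebra.algebraicClosure k K :=
    Algebra.adjoin_le (Set.singleton_subset_iff.mpr hcalg)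
  exact h2 h1
end

section
open Polynomial TrivSqZeroExt

/-- contractive elements of the dual numbers -/
def lpContr {K : Type*} [NormedField K] (x : TrivSqZeroExt K K) : Prop := ‖x.snd‖ ≤ ‖x.fst‖

theorem lpContr_mul {K : Type*} [NormedField K] [IsUltrametricDist K] {x y : TrivSqZeroExt K K}
    (hx : lpContr x) (hy : lpContr y) : lpContr (x * y) := by
  unfold lpContr at *
  rw [fst_mul, snd_mul]
  refine (IsUltrametricDist.norm_add_le_max _ _).trans (max_le ?_ ?_)
  · rw [smul_eq_mul, norm_mul, norm_mul]; gcongr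
  · rw [op_smul_eq_mul, norm_mul, norm_mul]; gcongr

theorem lpContr_pow {K : Type*} [NormedField K] [IsUltrametricDist K] {x : TrivSqZeroExt K K}
    (hx : lpContr x) (n : ℕ) : lpContr (x ^ n) := by
  induction n with
  | zero => simp [lpContr]
  | succ n ih => rw [pow_succ]; exact lpContr_mul ih hx

/-- The base contractive ring. -/
theorem lp_G0 {K : Type*} [NormedField K] [IsUltrametricDist K]
    (k : Subring K) (hk : ∀ z ∈ k, z ≠ 0 → ‖z‖ = 1) (ι : ℝ →+* K)
    (hι : ∀ r : ℝ, r ≠ 0 → ‖ι r‖ = 1)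
    (t : ℝ → K) (ht0 : t 0 = 1) (htadd : ∀ r s, t (r + s) = t r * t s)
    (htn : ∀ r, ‖t r‖ = Real.exp (-r)) :
    ∃ G : Subring (TrivSqZeroExt K K), (∀ x ∈ G, lpContr x) ∧ (∀ a ∈ k, inl a ∈ G) ∧
      ∀ r, inl (t r) + inr (ι r * t r) ∈ G := by
  let F : Multiplicative ℝ →* TrivSqZeroExt K K :=
    { toFun := fun r => inl (t r.toAdd) + inr (ι r.toAdd * t r.toAdd)
      map_one' := by ext <;> simp [ht0]
      map_mul' := fun r s => by
        ext
        · simp [htadd]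
        · simp [htadd]; ring }
  let Φ := AddMonoidAlgebra.lift k (TrivSqZeroExt K K) ℝ F
  refine ⟨Φ.range.toSubring, ?_, ?_, ?_⟩
  · rintro x ⟨b, rfl⟩
    set a := b.coeff with hab
    have hΦ : Φ b = ∑ r ∈ a.support, a r • F (Multiplicative.ofAdd r) := by
      change AddMonoidAlgebra.lift k (TrivSqZeroExt K K) ℝ F b = _
      rw [AddMonoidAlgebra.lift_apply]; rfl
    have hfst : (Φ b).fst = ∑ r ∈ a.support, (a r : K) * t r := by
      rw [hΦ, fst_sum]; refine Finset.sum_congr rfl fun r _ => ?_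
      simp [F, Subring.smul_def]
    have hsnd : (Φ b).snd = ∑ r ∈ a.support, (a r : K) * (ι r * t r) := by
      rw [hΦ, snd_sum]; refine Finset.sum_congr rfl fun r _ => ?_
      simp [F, Subring.smul_def]
    change ‖(Φ b).snd‖ ≤ ‖(Φ b).fst‖
    by_cases hne : a.support.Nonempty
    swap
    · rw [Finset.not_nonempty_iff_eq_empty] at hne
      rw [hfst, hsnd, hne]; simp
    set r0 := a.support.min' hne with hr0
    have hr0m : r0 ∈ a.support := Finset.min'_mem _ _
    have han : ∀ r ∈ a.support, ‖(a r : K)‖ = 1 := by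
      intro r hr
      refine hk _ (a r).2 ?_
      have := Finsupp.mem_support_iff.mp hr
      simpa using this
    have h1 : ‖(Φ b).snd‖ ≤ Real.exp (-r0) := by
      rw [hsnd]
      apply IsUltrametricDist.norm_sum_le_of_forall_le_of_nonneg (Real.exp_pos _).le
      intro r hr
      rw [norm_mul, norm_mul, han r hr, one_mul, htn]
      have : ‖ι r‖ ≤ 1 := by
        by_cases h : r = 0
        · simp [h]
        · exact (hι r h).le
      have h3 : Real.exp (-r) ≤ Real.exp (-r0) := by
        apply Real.exp_le_exp.mpr
        have := Finset.min'_le _ _ hr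
        linarith
      nlinarith [Real.exp_pos (-r)]
    have h2 : ‖(Φ b).fst - (a r0 : K) * t r0‖ < ‖(a r0 : K) * t r0‖ := by
      rw [hfst, ← Finset.add_sum_erase _ _ hr0m, add_sub_cancel_left, norm_mul, han _ hr0m, htn,
        one_mul]
      by_cases hne2 : (a.support.erase r0).Nonempty
      · obtain ⟨r, hr, hle⟩ := IsUltrametricDist.exists_norm_finsetSum_le_of_nonempty hne2
          (fun r => (a r : K) * t r)
        refine hle.trans_lt ?_
        rw [norm_mul, han _ (Finset.mem_of_mem_erase hr), one_mul, htn]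
        apply Real.exp_lt_exp.mpr
        have h4 := Finset.min'_le _ _ (Finset.mem_of_mem_erase hr)
        have h5 := Finset.ne_of_mem_erase hr
        have : r0 < r := lt_of_le_of_ne h4 (Ne.symm h5)
        linarith
      · rw [Finset.not_nonempty_iff_eq_empty] at hne2
        rw [hne2]; simp [Real.exp_pos]
    have h3 : ‖(Φ b).fst‖ = ‖(a r0 : K) * t r0‖ := by
      have := IsUltrametricDist.norm_add_eq_max_of_norm_ne_norm h2.ne
      rw [sub_add_cancel, max_eq_right h2.le] at this
      exact this
    rw [h3, norm_mul, han _ hr0m, one_mul, htn]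
    exact h1
  · intro a ha
    refine ⟨algebraMap k _ ⟨a, ha⟩, ?_⟩
    change Φ _ = _
    rw [AlgHom.commutes]
    rfl
  · intro r
    refine ⟨AddMonoidAlgebra.single r 1, ?_⟩
    change Φ _ = _
    simp only [Φ, AddMonoidAlgebra.lift_single, one_smul]
    rfl
end

section
open Polynomial TrivSqZeroExt

theorem lp_norm_sub_le_max {K : Type*} [NormedField K] [IsUltrametricDist K] (x y : K) :
    ‖x - y‖ ≤ max ‖x‖ ‖y‖ := by
  rw [sub_eq_add_neg]
  refine (IsUltrametricDist.norm_add_le_max x (-y)).trans ?_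
  rw [norm_neg]

theorem lp_maxG {K : Type*} [NormedField K] [IsUltrametricDist K] [CompleteSpace K] [IsAlgClosed K]
    (hnat : ∀ n : ℕ, n ≠ 0 → ‖(n : K)‖ = 1)
    (hsph : ∀ (b : ℕ → K) (r : ℕ → ℝ), (∀ i j, i ≤ j → ‖b i - b j‖ ≤ r i) →
      ∃ η, ∀ i, ‖η - b i‖ ≤ r i)
    (G0 : Subring (TrivSqZeroExt K K)) (hG0 : ∀ x ∈ G0, lpContr x)
    (hnt : ∃ x ∈ G0, 1 < ‖x.fst‖)
    (himm : ∀ w : K, w ≠ 0 → ∃ x ∈ G0, ‖w - x.fst‖ < ‖w‖) :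
    ∃ G : Subring (TrivSqZeroExt K K), G0 ≤ G ∧ (∀ x ∈ G, lpContr x) ∧ ∀ z, ∃ x ∈ G, x.fst = z := by
  obtain ⟨G, hle, hmax⟩ := zorn_le_nonempty₀
    {G : Subring (TrivSqZeroExt K K) | ∀ x ∈ G, lpContr x} (by
    intro c hc hch y hy
    refine ⟨sSup c, ?_, fun z hz => le_sSup hz⟩
    intro z hz
    rw [Subring.mem_sSup_of_directedOn ⟨y, hy⟩ hch.directedOn] at hz
    obtain ⟨s, hs, hzs⟩ := hz
    exact hc hs z hzs) G0 hG0
  have hG : ∀ x ∈ G, lpContr x := hmax.prop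
  have hzero : ∀ x ∈ G, x.fst = 0 → x = 0 := by
    intro x hx h0
    have := hG x hx
    unfold lpContr at this
    rw [h0, norm_zero, norm_le_zero_iff] at this
    ext
    · exact h0
    · exact this
  have hext : ∀ y : TrivSqZeroExt K K, (∀ g : G[X], lpContr (eval₂ G.subtype y g)) → y ∈ G := by
    intro y hy
    have h1 : (eval₂RingHom G.subtype y).range ≤ G := by
      apply hmax.le_of_ge
      · rintro z ⟨g, rfl⟩
        exact hy g
      · intro a ha
        exact ⟨C ⟨a, ha⟩, by simp⟩
    exact h1 ⟨X, by simp⟩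
  have hclG : IsClosed (G : Set (TrivSqZeroExt K K)) := by
    have h1 : G.topologicalClosure ≤ G := by
      apply hmax.le_of_ge _ G.le_topologicalClosure
      intro x hx
      have hcl : IsClosed {x : TrivSqZeroExt K K | lpContr x} :=
        isClosed_le (TrivSqZeroExt.continuous_snd.norm) (TrivSqZeroExt.continuous_fst.norm)
      exact closure_minimal (fun x hx => hG x hx) hcl hx
    have h2 : closure (G : Set (TrivSqZeroExt K K)) ⊆ G := h1
    exact closure_subset_iff_isClosed.mp h2
  have hinv : ∀ x ∈ G, x.fst ≠ 0 → ∃ y ∈ G, x * y = 1 := by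
    intro x hx hx0
    let y : TrivSqZeroExt K K := inl (x.fst⁻¹) + inr (-(x.snd * x.fst⁻¹ ^ 2))
    have hxy : x * y = 1 := by
      ext
      · simp [y, hx0]
      · simp [y]; field_simp; ring
    have hyc : lpContr y := by
      have h1 : ‖x.snd‖ ≤ ‖x.fst‖ := hG x hx
      have h2 : y.snd = -(x.snd * x.fst⁻¹ ^ 2) := by simp [y]
      have h3 : y.fst = x.fst⁻¹ := by simp [y]
      unfold lpContr
      rw [h2, h3, norm_neg, norm_mul, norm_pow, norm_inv, sq, ← mul_assoc]
      have h4 : 0 < ‖x.fst‖ := norm_pos_iff.mpr hx0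
      have h5 : ‖x.snd‖ * ‖x.fst‖⁻¹ ≤ 1 := by
        rw [← div_eq_mul_inv]; exact (div_le_one h4).mpr h1
      have h6 : 0 ≤ ‖x.fst‖⁻¹ := by positivity
      nlinarith
    refine ⟨y, hext y ?_, hxy⟩
    intro g
    have h1 : ∃ n, eval₂ G.subtype y g * x ^ n ∈ G := by
      induction g using Polynomial.induction_on' with
      | add p q hp hq =>
        obtain ⟨n, hn⟩ := hp
        obtain ⟨m, hm⟩ := hq
        refine ⟨n + m, ?_⟩
        rw [eval₂_add, add_mul, pow_add, ← mul_assoc]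
        refine G.add_mem (G.mul_mem hn (pow_mem hx _)) ?_
        rw [mul_comm (x ^ n), ← mul_assoc]
        exact (G.mul_mem hm (pow_mem hx _))
      | monomial n a =>
        refine ⟨n, ?_⟩
        rw [eval₂_monomial, mul_assoc, ← mul_pow, mul_comm y, hxy, one_pow, mul_one]
        exact a.2
    obtain ⟨n, hn⟩ := h1
    have h2 : eval₂ G.subtype y g = (eval₂ G.subtype y g * x ^ n) * y ^ n := by
      rw [mul_assoc, ← mul_pow, hxy, one_pow, mul_one]
    rw [h2]
    exact lpContr_mul (hG _ hn) (lpContr_pow hyc n)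
  let fstH : TrivSqZeroExt K K →+* K := (fstHom K K K).toRingHom
  let L : Subfield K :=
    { (G.map fstH) with
      inv_mem' := by
        rintro z ⟨x, hx, rfl⟩
        by_cases h0 : x.fst = 0
        · refine ⟨x, hx, ?_⟩
          change x.fst = x.fst⁻¹
          rw [h0, inv_zero]
        · obtain ⟨y, hy, hxy⟩ := hinv x hx h0
          refine ⟨y, hy, ?_⟩
          change y.fst = x.fst⁻¹
          have := congrArg TrivSqZeroExt.fst hxy
          rw [fst_mul, fst_one] at this
          exact (eq_inv_of_mul_eq_one_right this) }
  have hL : ∀ z, z ∈ L ↔ ∃ x ∈ G, x.fst = z := fun z => Iff.rfl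
  have hLcl : IsClosed (L : Set K) := by
    apply isClosed_of_closure_subset
    intro z hz
    rw [mem_closure_iff_seq_limit] at hz
    obtain ⟨u, hu, hlim⟩ := hz
    choose g hg hgu using fun n => (hL (u n)).mp (hu n)
    have hcs : CauchySeq (fun n => (g n).snd) := by
      have hcu := hlim.cauchySeq
      rw [Metric.cauchySeq_iff] at hcu ⊢
      intro ε hε
      obtain ⟨N, hN⟩ := hcu ε hε
      refine ⟨N, fun m hm n hn => lt_of_le_of_lt ?_ (hN m hm n hn)⟩
      have := hG _ (G.sub_mem (hg m) (hg n))
      unfold lpContr at this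
      rw [snd_sub, fst_sub, hgu, hgu] at this
      rw [dist_eq_norm, dist_eq_norm]; exact this
    obtain ⟨w, hw⟩ := cauchySeq_tendsto_of_complete hcs
    have h1 : Tendsto (fun n => (inl (u n) + inr ((g n).snd) : TrivSqZeroExt K K)) atTop
        (𝓝 (inl z + inr w)) :=
      ((TrivSqZeroExt.continuous_inl.tendsto z).comp hlim).add ((TrivSqZeroExt.continuous_inr.tendsto w).comp hw)
    have h2 : (inl z + inr w : TrivSqZeroExt K K) ∈ G := by
      refine hclG.mem_of_tendsto h1 (Eventually.of_forall fun n => ?_)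
      rw [← hgu n, inl_fst_add_inr_snd_eq]
      exact hg n
    exact (hL z).mpr ⟨_, h2, by simp⟩
  have himmL : ∀ w : K, w ≠ 0 → ∃ c ∈ L, ‖w - c‖ < ‖w‖ := by
    intro w hw
    obtain ⟨x, hx, h⟩ := himm w hw
    exact ⟨x.fst, (hL _).mpr ⟨x, hle hx, rfl⟩, h⟩
  have halg : ∀ z : K, IsAlgebraic L z → z ∈ L := by
    obtain ⟨x, hx, h⟩ := hnt
    exact lp_alg_mem hnat L hLcl ⟨x.fst, (hL _).mpr ⟨x, hle hx, rfl⟩, h⟩ himmL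
  refine ⟨G, hle, hG, ?_⟩
  intro y
  by_contra hy
  have hyL : y ∉ L := fun h => hy ((hL y).mp h)
  -- find η
  have hη : ∃ η, ∀ x ∈ G, ‖η - x.snd‖ ≤ ‖y - x.fst‖ := by
    let S : Set ℝ := {ρ | ∃ x ∈ G, ρ = ‖y - x.fst‖}
    obtain ⟨u, hanti, hlim, hmem⟩ := exists_seq_tendsto_sInf (S := S) ⟨_, 0, G.zero_mem, rfl⟩
      ⟨0, by rintro ρ ⟨x, _, rfl⟩; exact norm_nonneg _⟩
    choose x hx hux using hmem
    obtain ⟨η, hη⟩ := hsph (fun n => (x n).snd) u (by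
      intro i j hij
      have h1 := hG _ (G.sub_mem (hx i) (hx j))
      unfold lpContr at h1
      rw [snd_sub, fst_sub] at h1
      refine h1.trans ?_
      have h2 : (x i).fst - (x j).fst = (y - (x j).fst) - (y - (x i).fst) := by ring
      rw [h2]
      refine (lp_norm_sub_le_max _ _).trans (max_le ?_ ?_)
      · rw [← hux]; exact hanti hij
      · rw [← hux])
    refine ⟨η, fun g hg => ?_⟩
    have hne : y - g.fst ≠ 0 := by
      intro h; apply hyL; rw [sub_eq_zero.mp h]; exact (hL _).mpr ⟨g, hg, rfl⟩
    obtain ⟨c, hc, hlt⟩ := himmL _ hne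
    obtain ⟨h, hh, rfl⟩ := (hL c).mp hc
    have hinf : sInf S < ‖y - g.fst‖ := by
      refine lt_of_le_of_lt (csInf_le ⟨0, by rintro ρ ⟨x, _, rfl⟩; exact norm_nonneg _⟩ ?_) hlt
      exact ⟨g + h, G.add_mem hg hh, by rw [fst_add]; congr 1; ring⟩
    obtain ⟨n, hn⟩ := (hlim.eventually_lt_const hinf).exists
    have e1 := hη n
    have e2 := hG _ (G.sub_mem (hx n) hg)
    unfold lpContr at e2
    rw [snd_sub, fst_sub] at e2
    have e3 : (x n).fst - g.fst = (y - g.fst) - (y - (x n).fst) := by ring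
    have e4 : η - g.snd = (η - (x n).snd) + ((x n).snd - g.snd) := by ring
    rw [e4]
    refine (IsUltrametricDist.norm_add_le_max _ _).trans (max_le (e1.trans hn.le) (e2.trans ?_))
    rw [e3]
    refine (lp_norm_sub_le_max _ _).trans (max_le le_rfl ?_)
    rw [← hux]; exact hn.le
  obtain ⟨η, hη⟩ := hη
  let Y : TrivSqZeroExt K K := inl y + inr η
  have hYf : Y.fst = y := by simp [Y]
  have hYs : Y.snd = η := by simp [Y]
  refine hy ⟨Y, hext Y ?_, hYf⟩
  have main : ∀ n : ℕ, ∀ p : G[X], p.natDegree = n → lpContr (eval₂ G.subtype Y p) := by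
    intro n
    induction n with
    | zero =>
      intro p hp
      rw [eq_C_of_natDegree_eq_zero hp, eval₂_C]
      exact hG _ (Subtype.mem _)
    | succ n ih =>
      intro p hp
      let fG : G →+* K := fstH.comp G.subtype
      have hfGinj : Function.Injective fG := by
        rw [injective_iff_map_eq_zero]
        intro a ha
        have := hzero a a.2 ha
        exact Subtype.ext this
      have hpne : p ≠ 0 := by rintro rfl; simp at hp
      obtain ⟨z, hz⟩ := IsAlgClosed.exists_root (p.map fG) (by
        rw [degree_map_eq_of_injective hfGinj, degree_eq_natDegree hpne, hp]
        simp; exact_mod_cast (Nat.succ_ne_zero n))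
      have hzL : z ∈ L := by
        apply halg
        let j : G →+* L := fG.codRestrict L (fun a => (hL _).mpr ⟨a, a.2, rfl⟩)
        refine ⟨p.map j, ?_, ?_⟩
        · rw [Polynomial.map_ne_zero_iff]
          · exact hpne
          · intro a b hab
            apply hfGinj
            exact congrArg Subtype.val hab
        · rw [aeval_def, eval₂_map]
          rw [IsRoot.def, eval_map] at hz
          exact hz
      obtain ⟨g, hg, rfl⟩ := (hL z).mp hzL
      have hroot : p.IsRoot ⟨g, hg⟩ := by
        apply hfGinj
        rw [map_zero]
        rw [IsRoot.def, eval_map] at hz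
        rw [← hz, ← Polynomial.eval₂_at_apply]
        rfl
      obtain ⟨q, hq⟩ := dvd_iff_isRoot.mpr hroot
      have : Nontrivial G := ⟨⟨0, 1, fun h => by
        have := congrArg fG h; simp at this⟩⟩
      have hqd : q.natDegree = n := by
        have hq0 : q ≠ 0 := by rintro rfl; exact hpne (by rw [hq, mul_zero])
        have h1 := (monic_X_sub_C (⟨g, hg⟩ : G)).natDegree_mul' hq0
        rw [← hq, hp, natDegree_X_sub_C] at h1
        omega
      rw [hq, eval₂_mul]
      refine lpContr_mul ?_ (ih q hqd)
      rw [eval₂_sub, eval₂_X, eval₂_C]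
      unfold lpContr
      change ‖(Y - g).snd‖ ≤ ‖(Y - g).fst‖
      rw [snd_sub, fst_sub, hYf, hYs]
      exact hη g hg
  exact fun g => main _ g rfl

theorem lp_derivation {K : Type*} [NormedField K] [IsUltrametricDist K] [CompleteSpace K]
    [IsAlgClosed K]
    (hsph : ∀ (b : ℕ → K) (r : ℕ → ℝ), (∀ i j, i ≤ j → ‖b i - b j‖ ≤ r i) →
      ∃ η, ∀ i, ‖η - b i‖ ≤ r i)
    (ι : ℝ →+* K) (hι : ∀ r : ℝ, r ≠ 0 → ‖ι r‖ = 1)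
    (t : ℝ → K) (ht0 : t 0 = 1) (htadd : ∀ r s, t (r + s) = t r * t s)
    (htn : ∀ r, ‖t r‖ = Real.exp (-r))
    (k0 : Subring K) (hk0 : ∀ z ∈ k0, z ≠ 0 → ‖z‖ = 1) :
    ∃ D : K → K, (∀ x y, D (x + y) = D x + D y) ∧ (∀ x y, D (x * y) = x * D y + y * D x) ∧
      (∀ z ∈ k0, D z = 0) ∧ (∀ z, ‖z‖ ≤ 1 → ‖D z‖ < 1) ∧
      (∀ z, ‖z‖ = Real.exp (-1) → ‖D z‖ = Real.exp (-1)) := by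
  obtain ⟨k, hk0k, hk, hres⟩ := lp_coeff_field k0 hk0
  obtain ⟨G0, hG0, hG0k, hG0t⟩ := lp_G0 k hk ι hι t ht0 htadd htn
  have ht_ne : ∀ r, t r ≠ 0 := fun r h => by
    have := htn r; rw [h, norm_zero] at this; exact (Real.exp_pos _).ne this
  have happ : ∀ w : K, w ≠ 0 → ∃ c ∈ k, ‖w - c * t (-Real.log ‖w‖)‖ < ‖w‖ := by
    intro w hw
    set r := -Real.log ‖w‖ with hr
    have hwn : 0 < ‖w‖ := norm_pos_iff.mpr hw
    have htr : ‖t r‖ = ‖w‖ := by rw [htn, hr, neg_neg, Real.exp_log hwn]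
    obtain ⟨c, hc, hlt⟩ := hres (w / t r) (by rw [norm_div, htr, div_self hwn.ne'])
    refine ⟨c, hc, ?_⟩
    have h1 : w - c * t r = (w / t r - c) * t r := by field_simp [ht_ne r]
    rw [h1, norm_mul, htr]
    nlinarith
  obtain ⟨G, hle, hG, hsurj⟩ := lp_maxG (K := K) (by
      intro n hn
      have := hι n (by exact_mod_cast hn)
      rwa [map_natCast] at this) hsph G0 hG0
    ⟨_, hG0t (-1), by
      simp only [fst_add, fst_inl, fst_inr, add_zero, htn, neg_neg]
      exact Real.one_lt_exp_iff.mpr one_pos⟩ (by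
      intro w hw
      obtain ⟨c, hc, h⟩ := happ w hw
      exact ⟨_, G0.mul_mem (hG0k c hc) (hG0t (-Real.log ‖w‖)), by simpa using h⟩)
  have huniq : ∀ x ∈ G, ∀ y ∈ G, x.fst = y.fst → x.snd = y.snd := by
    intro x hx y hy h
    have := hG _ (G.sub_mem hx hy)
    unfold lpContr at this
    rw [fst_sub, snd_sub, h, sub_self, norm_zero, norm_le_zero_iff, sub_eq_zero] at this
    exact this
  choose g hg hgz using hsurj
  have hD : ∀ x ∈ G, (g x.fst).snd = x.snd := fun x hx => huniq _ (hg _) _ hx (hgz _)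
  have hcontr : ∀ z, ‖(g z).snd‖ ≤ ‖z‖ := fun z => by
    have := hG _ (hg z); unfold lpContr at this; rwa [hgz] at this
  have hadd : ∀ x y, (g (x + y)).snd = (g x).snd + (g y).snd := fun x y => by
    have := hD _ (G.add_mem (hg x) (hg y))
    rwa [fst_add, hgz, hgz, snd_add] at this
  have hDk : ∀ z ∈ k, (g z).snd = 0 := fun z hz => by
    have := hD _ (hle (hG0k z hz)); simpa using this
  have hsub : ∀ x y, (g x).snd = (g (x - y)).snd + (g y).snd := fun x y => by
    rw [← hadd, sub_add_cancel]
  refine ⟨fun z => (g z).snd, hadd, ?_, fun z hz => hDk z (hk0k hz), ?_, ?_⟩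
  · intro x y
    have := hD _ (G.mul_mem (hg x) (hg y))
    rw [fst_mul, hgz, hgz, snd_mul, hgz, hgz] at this
    simpa [mul_comm] using this
  · intro z hz
    obtain ⟨c, hc, hlt⟩ := hres z hz
    change ‖(g z).snd‖ < 1
    rw [hsub z c, hDk c hc, add_zero]
    exact (hcontr _).trans_lt hlt
  · intro z hz
    have hz0 : z ≠ 0 := by
      rintro rfl; rw [norm_zero] at hz; exact (Real.exp_pos _).ne hz
    obtain ⟨c, hc, hlt⟩ := happ z hz0
    rw [hz, Real.log_exp, neg_neg] at hlt
    have h1 : (g (c * t 1)).snd = c * t 1 := by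
      have := hD _ (hle (G0.mul_mem (hG0k c hc) (hG0t 1)))
      simpa using this
    change ‖(g z).snd‖ = _
    have h2 : ‖(g z).snd - z‖ < ‖z‖ := by
      rw [hsub z (c * t 1), h1]
      have : (g (z - c * t 1)).snd + c * t 1 - z = (g (z - c * t 1)).snd - (z - c * t 1) := by ring
      rw [this, hz]
      refine lt_of_le_of_lt (lp_norm_sub_le_max _ _) (max_lt ?_ hlt)
      exact (hcontr _).trans_lt hlt
    have := IsUltrametricDist.norm_add_eq_max_of_norm_ne_norm h2.ne
    rw [sub_add_cancel, max_eq_right h2.le] at this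
    rw [this, hz]
end

section
/-- A nonprincipal ultrafilter on the naturals. -/
def lpU : Ultrafilter ℕ := hyperfilter ℕ

theorem lpU_le : (lpU : Filter ℕ) ≤ atTop := Nat.hyperfilter_le_atTop

def lpModerate (ε : ℕ → ℝ) (z : ℕ → ℂ) : Prop :=
  ∃ M : ℝ, ∀ᶠ k in (lpU : Filter ℕ), ‖z k‖ ^ ε k ≤ M

theorem lpModerate_of_le {ε : ℕ → ℝ} (hpos : ∀ k, 0 < ε k) {z w : ℕ → ℂ}
    (h : ∀ᶠ k in (lpU : Filter ℕ), ‖z k‖ ≤ ‖w k‖) (hw : lpModerate ε w) : lpModerate ε z := by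
  obtain ⟨M, hM⟩ := hw
  refine ⟨M, ?_⟩
  filter_upwards [h, hM] with k h1 h2
  exact (Real.rpow_le_rpow (norm_nonneg _) h1 (hpos k).le).trans h2

theorem lp_add_rpow {x y e : ℝ} (hx : 0 ≤ x) (hy : 0 ≤ y) (he : 0 < e) :
    (x + y) ^ e ≤ 2 ^ e * max (x ^ e) (y ^ e) := by
  rw [← Real.rpow_max hx hy he.le, ← Real.mul_rpow (by norm_num) (le_max_of_le_left hx)]
  refine Real.rpow_le_rpow (by positivity) ?_ he.le
  have := le_max_left x y
  have := le_max_right x y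
  linarith

theorem lp_two_rpow {ε : ℕ → ℝ} (hlim : Tendsto ε atTop (𝓝 0)) (c : ℝ) (hc : 0 < c) :
    Tendsto (fun k => c ^ ε k) (lpU : Filter ℕ) (𝓝 1) := by
  have h := (hlim.mono_left lpU_le)
  have h2 : Tendsto (fun k => c ^ ε k) (lpU : Filter ℕ) (𝓝 (c ^ (0 : ℝ))) :=
    ((Real.continuous_const_rpow hc.ne').tendsto 0).comp h
  simpa using h2

theorem lpModerate_add {ε : ℕ → ℝ} (hpos : ∀ k, 0 < ε k) (hlim : Tendsto ε atTop (𝓝 0))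
    {z w : ℕ → ℂ} (hz : lpModerate ε z) (hw : lpModerate ε w) : lpModerate ε (z + w) := by
  obtain ⟨M, hM⟩ := hz
  obtain ⟨M', hM'⟩ := hw
  refine ⟨2 * max M M', ?_⟩
  have h2 := (lp_two_rpow hlim 2 (by norm_num)).eventually_lt_const (by norm_num : (1 : ℝ) < 2)
  filter_upwards [hM, hM', h2] with k h1 h3 h4
  calc ‖z k + w k‖ ^ ε k ≤ (‖z k‖ + ‖w k‖) ^ ε k :=
        Real.rpow_le_rpow (norm_nonneg _) (norm_add_le _ _) (hpos k).le
    _ ≤ 2 ^ ε k * max (‖z k‖ ^ ε k) (‖w k‖ ^ ε k) :=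
        lp_add_rpow (norm_nonneg _) (norm_nonneg _) (hpos k)
    _ ≤ 2 * max M M' := by
        have h5 : max (‖z k‖ ^ ε k) (‖w k‖ ^ ε k) ≤ max M M' := max_le_max h1 h3
        have h6 : 0 ≤ max (‖z k‖ ^ ε k) (‖w k‖ ^ ε k) := le_max_of_le_left (by positivity)
        gcongr

theorem lpModerate_mul {ε : ℕ → ℝ}
    {z w : ℕ → ℂ} (hz : lpModerate ε z) (hw : lpModerate ε w) : lpModerate ε (z * w) := by
  obtain ⟨M, hM⟩ := hz
  obtain ⟨M', hM'⟩ := hw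
  refine ⟨M * M', ?_⟩
  filter_upwards [hM, hM'] with k h1 h3
  have h0 : 0 ≤ ‖z k‖ ^ ε k := by positivity
  rw [Pi.mul_apply, norm_mul, Real.mul_rpow (norm_nonneg _) (norm_nonneg _)]
  exact mul_le_mul h1 h3 (by positivity) (h0.trans h1)

theorem lpModerate_one (ε : ℕ → ℝ) : lpModerate ε 1 :=
  ⟨1, Eventually.of_forall fun k => by simp⟩

theorem lpModerate_neg {ε : ℕ → ℝ} {z : ℕ → ℂ} (hz : lpModerate ε z) : lpModerate ε (-z) := by
  obtain ⟨M, hM⟩ := hz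
  exact ⟨M, by simpa using hM⟩

/-- The ring of moderate sequences. -/
def lpMod (ε : ℕ → ℝ) (hpos : ∀ k, 0 < ε k) (hlim : Tendsto ε atTop (𝓝 0)) :
    Subring (ℕ → ℂ) where
  carrier := {z | lpModerate ε z}
  mul_mem' := fun ha hb => lpModerate_mul ha hb
  one_mem' := lpModerate_one ε
  add_mem' := fun ha hb => lpModerate_add hpos hlim ha hb
  zero_mem' := ⟨0, Eventually.of_forall fun k => by simp [Real.zero_rpow (hpos k).ne']⟩
  neg_mem' := fun ha => lpModerate_neg ha

section
variable {ε : ℕ → ℝ} {hpos : ∀ k, 0 < ε k} {hlim : Tendsto ε atTop (𝓝 0)}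

theorem lp_exists_lim (z : lpMod ε hpos hlim) :
    ∃ l : ℝ, Tendsto (fun k => ‖z.1 k‖ ^ ε k) (lpU : Filter ℕ) (𝓝 l) := by
  obtain ⟨M, hM⟩ := z.2
  have h1 : ∀ᶠ k in (lpU : Filter ℕ), ‖z.1 k‖ ^ ε k ∈ Set.Icc 0 M := by
    filter_upwards [hM] with k hk
    exact ⟨by positivity, hk⟩
  obtain ⟨l, -, hl⟩ := (isCompact_Icc (a := (0 : ℝ)) (b := M)).ultrafilter_le_nhds'
    (lpU.map (fun k => ‖z.1 k‖ ^ ε k)) h1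
  exact ⟨l, hl⟩

def lpNu (z : lpMod ε hpos hlim) : ℝ := (lp_exists_lim z).choose

theorem lpNu_tendsto (z : lpMod ε hpos hlim) :
    Tendsto (fun k => ‖z.1 k‖ ^ ε k) (lpU : Filter ℕ) (𝓝 (lpNu z)) := (lp_exists_lim z).choose_spec

theorem lpNu_eq {z : lpMod ε hpos hlim} {l : ℝ}
    (h : Tendsto (fun k => ‖z.1 k‖ ^ ε k) (lpU : Filter ℕ) (𝓝 l)) : lpNu z = l :=
  tendsto_nhds_unique (lpNu_tendsto z) h

theorem lpNu_nonneg (z : lpMod ε hpos hlim) : 0 ≤ lpNu z :=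
  ge_of_tendsto (lpNu_tendsto z) (Eventually.of_forall fun k => by positivity)

theorem lpNu_mul (z w : lpMod ε hpos hlim) : lpNu (z * w) = lpNu z * lpNu w := by
  apply lpNu_eq
  refine ((lpNu_tendsto z).mul (lpNu_tendsto w)).congr fun k => ?_
  rw [← Real.mul_rpow (norm_nonneg _) (norm_nonneg _), ← norm_mul]
  rfl

theorem lpNu_add (z w : lpMod ε hpos hlim) : lpNu (z + w) ≤ max (lpNu z) (lpNu w) := by
  have h1 := ((lp_two_rpow hlim 2 (by norm_num)).mul ((lpNu_tendsto z).max (lpNu_tendsto w)))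
  rw [one_mul] at h1
  refine le_of_tendsto_of_tendsto (lpNu_tendsto (z + w)) h1 (Eventually.of_forall fun k => ?_)
  calc ‖z.1 k + w.1 k‖ ^ ε k ≤ (‖z.1 k‖ + ‖w.1 k‖) ^ ε k :=
        Real.rpow_le_rpow (norm_nonneg _) (norm_add_le _ _) (hpos k).le
    _ ≤ 2 ^ ε k * max (‖z.1 k‖ ^ ε k) (‖w.1 k‖ ^ ε k) :=
        lp_add_rpow (norm_nonneg _) (norm_nonneg _) (hpos k)

theorem lpNu_one : lpNu (1 : lpMod ε hpos hlim) = 1 := by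
  apply lpNu_eq
  simp

theorem lpNu_neg (z : lpMod ε hpos hlim) : lpNu (-z) = lpNu z := by
  apply lpNu_eq
  simpa using lpNu_tendsto z

theorem lpNu_eventually_zero (z : lpMod ε hpos hlim)
    (h : ∀ᶠ k in (lpU : Filter ℕ), z.1 k = 0) : lpNu z = 0 := by
  apply lpNu_eq
  refine tendsto_const_nhds.congr' ?_
  filter_upwards [h] with k hk
  rw [hk, norm_zero, Real.zero_rpow (hpos k).ne']

variable (ε hpos hlim) in
def lpI : Ideal (lpMod ε hpos hlim) where
  carrier := {z | lpNu z = 0}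
  add_mem' := by
    intro a b ha hb
    have h := lpNu_add a b
    rw [show lpNu a = 0 from ha, show lpNu b = 0 from hb, max_self] at h
    exact le_antisymm h (lpNu_nonneg _)
  zero_mem' := lpNu_eventually_zero _ (Eventually.of_forall fun k => rfl)
  smul_mem' := by
    intro c x hx
    change lpNu (c * x) = 0
    rw [lpNu_mul, show lpNu x = 0 from hx, mul_zero]

theorem lp_mem_I (z : lpMod ε hpos hlim) : z ∈ lpI ε hpos hlim ↔ lpNu z = 0 := Iff.rfl

theorem lpNu_congr {z w : lpMod ε hpos hlim} (h : lpNu (z - w) = 0) : lpNu z = lpNu w := by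
  have h2 : lpNu (w - z) = 0 := by rw [← neg_sub, lpNu_neg, h]
  have h1 := lpNu_add (z - w) w
  have h3 := lpNu_add (w - z) z
  rw [sub_add_cancel, h, max_eq_right (lpNu_nonneg _)] at h1
  rw [sub_add_cancel, h2, max_eq_right (lpNu_nonneg _)] at h3
  exact le_antisymm h1 h3

theorem lp_exists_inv (z : lpMod ε hpos hlim) (hz : lpNu z ≠ 0) :
    ∃ w : lpMod ε hpos hlim, lpNu (z * w - 1) = 0 := by
  have hz' : 0 < lpNu z := lt_of_le_of_ne (lpNu_nonneg z) hz.symm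
  have h1 : lpModerate ε (fun k => (z.1 k)⁻¹) := by
    refine ⟨(lpNu z)⁻¹ + 1, ?_⟩
    have h2 := ((lpNu_tendsto z).inv₀ hz).eventually_lt_const (lt_add_one _)
    filter_upwards [h2] with k hk
    rw [norm_inv, Real.inv_rpow (norm_nonneg _)]
    exact hk.le
  refine ⟨⟨_, h1⟩, lpNu_eventually_zero _ ?_⟩
  have h2 := (lpNu_tendsto z).eventually_const_lt hz'
  filter_upwards [h2] with k hk
  have h3 : z.1 k ≠ 0 := by
    intro h
    rw [h, norm_zero, Real.zero_rpow (hpos k).ne'] at hk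
    exact lt_irrefl _ hk
  change z.1 k * (z.1 k)⁻¹ - 1 = 0
  rw [mul_inv_cancel₀ h3, sub_self]

instance lpI_max : (lpI ε hpos hlim).IsMaximal := by
  apply Ideal.Quotient.maximal_of_isField
  refine ⟨⟨0, 1, ?_⟩, mul_comm, ?_⟩
  · intro h
    have : (Ideal.Quotient.mk (lpI ε hpos hlim)) 1 = 0 := h.symm
    rw [Ideal.Quotient.eq_zero_iff_mem, lp_mem_I, lpNu_one] at this
    exact one_ne_zero this
  · intro a ha
    obtain ⟨z, rfl⟩ := Ideal.Quotient.mk_surjective a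
    obtain ⟨w, hw⟩ := lp_exists_inv z (fun h => ha (Ideal.Quotient.eq_zero_iff_mem.mpr h))
    refine ⟨Ideal.Quotient.mk _ w, ?_⟩
    rw [← map_mul, ← map_one (Ideal.Quotient.mk (lpI ε hpos hlim)), Ideal.Quotient.eq]
    exact hw

variable (ε hpos hlim) in
def lpK : Type := lpMod ε hpos hlim ⧸ lpI ε hpos hlim

instance : Field (lpK ε hpos hlim) := Ideal.Quotient.field (lpI ε hpos hlim)

variable (ε hpos hlim) in
def lpPhi : lpMod ε hpos hlim →+* lpK ε hpos hlim := Ideal.Quotient.mk (lpI ε hpos hlim)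

theorem lpPhi_surj : Function.Surjective (lpPhi ε hpos hlim) := Ideal.Quotient.mk_surjective

theorem lpPhi_eq_zero (z : lpMod ε hpos hlim) : lpPhi ε hpos hlim z = 0 ↔ lpNu z = 0 :=
  Ideal.Quotient.eq_zero_iff_mem

def lpAbsFun (x : lpK ε hpos hlim) : ℝ := lpNu (lpPhi_surj x).choose

theorem lpAbsFun_phi (z : lpMod ε hpos hlim) : lpAbsFun (lpPhi ε hpos hlim z) = lpNu z := by
  unfold lpAbsFun
  apply lpNu_congr
  rw [← lpPhi_eq_zero, map_sub, (lpPhi_surj (lpPhi ε hpos hlim z)).choose_spec, sub_self]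

variable (ε hpos hlim) in
def lpAbs : AbsoluteValue (lpK ε hpos hlim) ℝ where
  toFun := lpAbsFun
  map_mul' := by
    intro x y
    obtain ⟨z, rfl⟩ := lpPhi_surj x
    obtain ⟨w, rfl⟩ := lpPhi_surj y
    rw [← map_mul, lpAbsFun_phi, lpAbsFun_phi, lpAbsFun_phi, lpNu_mul]
  nonneg' := by
    intro x
    exact lpNu_nonneg _
  eq_zero' := by
    intro x
    obtain ⟨z, rfl⟩ := lpPhi_surj x
    rw [lpAbsFun_phi, lpPhi_eq_zero]
  add_le' := by
    intro x y
    obtain ⟨z, rfl⟩ := lpPhi_surj x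
    obtain ⟨w, rfl⟩ := lpPhi_surj y
    rw [← map_add, lpAbsFun_phi, lpAbsFun_phi, lpAbsFun_phi]
    exact (lpNu_add z w).trans (max_le_add_of_nonneg (lpNu_nonneg _) (lpNu_nonneg _))

instance : NormedField (lpK ε hpos hlim) := AbsoluteValue.toNormedField (lpAbs ε hpos hlim)

theorem lp_norm_phi (z : lpMod ε hpos hlim) : ‖lpPhi ε hpos hlim z‖ = lpNu z := lpAbsFun_phi z

instance : IsUltrametricDist (lpK ε hpos hlim) := by
  apply IsUltrametricDist.isUltrametricDist_of_forall_norm_add_le_max_norm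
  intro x y
  obtain ⟨z, rfl⟩ := lpPhi_surj x
  obtain ⟨w, rfl⟩ := lpPhi_surj y
  rw [← map_add, lp_norm_phi, lp_norm_phi, lp_norm_phi]
  exact lpNu_add z w

end
end

section
section
variable {ε : ℕ → ℝ} {hpos : ∀ k, 0 < ε k} {hlim : Tendsto ε atTop (𝓝 0)}

theorem lp_sph_aux (β : ℕ → lpMod ε hpos hlim) (r : ℕ → ℝ)
    (h : ∀ i j, i ≤ j → lpNu (β i - β j) ≤ r i) :
    ∃ η : lpMod ε hpos hlim, ∀ i, lpNu (β i - η) ≤ r i := by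
  classical
  let S : ℕ → ℕ → Prop := fun j k =>
    ∀ i ≤ j, ‖(β i).1 k - (β j).1 k‖ ^ ε k ≤ r i + 1 / ((j : ℝ) + 1)
  have hS : ∀ j, ∀ᶠ k in (lpU : Filter ℕ), S j k := by
    intro j
    have h1 : ∀ i ∈ Finset.range (j + 1), ∀ᶠ k in (lpU : Filter ℕ),
        ‖(β i).1 k - (β j).1 k‖ ^ ε k ≤ r i + 1 / ((j : ℝ) + 1) := by
      intro i hi
      have h2 := h i j (Nat.lt_succ_iff.mp (Finset.mem_range.mp hi))
      have h3 : lpNu (β i - β j) < r i + 1 / ((j : ℝ) + 1) := by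
        have : 0 < 1 / ((j : ℝ) + 1) := by positivity
        linarith
      exact ((lpNu_tendsto (β i - β j)).eventually_lt_const h3).mono fun k hk => le_of_lt hk
    rw [← Filter.eventually_all_finset] at h1
    filter_upwards [h1] with k hk i hi
    exact hk i (Finset.mem_range.mpr (Nat.lt_succ_of_le hi))
  obtain ⟨J, hJ⟩ : ∃ J : ℕ → ℕ, ∀ k j, j ≤ k → S j k → j ≤ J k ∧ S (J k) k :=
    ⟨fun k => Nat.findGreatest (fun j => S j k) k, fun k j hjk hk =>
      ⟨Nat.le_findGreatest hjk hk, Nat.findGreatest_spec (P := fun j => S j k) hjk hk⟩⟩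
  have key : ∀ i j, i ≤ j → ∀ᶠ k in (lpU : Filter ℕ),
      ‖(β i).1 k - (β (J k)).1 k‖ ^ ε k ≤ r i + 1 / ((j : ℝ) + 1) := by
    intro i j hij
    have h1 : ∀ᶠ k in (lpU : Filter ℕ), j ≤ k := lpU_le (eventually_ge_atTop j)
    filter_upwards [hS j, h1] with k hk hjk
    obtain ⟨h2, h3⟩ := hJ k j hjk hk
    refine (h3 i (hij.trans h2)).trans ?_
    have : (j : ℝ) ≤ J k := by exact_mod_cast h2
    gcongr
  obtain ⟨η, hη⟩ : ∃ η : ℕ → ℂ, (fun k => (β (J k)).1 k) = η := ⟨_, rfl⟩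
  have key' : ∀ i j, i ≤ j → ∀ᶠ k in (lpU : Filter ℕ),
      ‖(β i).1 k - η k‖ ^ ε k ≤ r i + 1 / ((j : ℝ) + 1) := by
    subst hη; exact key
  have hmod : lpModerate ε η := by
    have h1 : lpModerate ε ((β 0).1 - η) := ⟨_, key' 0 0 le_rfl⟩
    have h2 := lpModerate_add hpos hlim (β 0).2 (lpModerate_neg h1)
    have h3 : (β 0).1 + -((β 0).1 - η) = η := by abel
    rwa [h3] at h2
  obtain ⟨E, hE⟩ : ∃ E : lpMod ε hpos hlim, E.1 = η := ⟨⟨η, hmod⟩, rfl⟩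
  refine ⟨E, fun i => ?_⟩
  have h0 : ∀ k, (β i - E).1 k = (β i).1 k - η k := fun k => by rw [← hE]; rfl
  have h1 : ∀ j ≥ i, lpNu (β i - E) ≤ r i + 1 / ((j : ℝ) + 1) := fun j hj => by
    refine le_of_tendsto (lpNu_tendsto (β i - E)) ?_
    filter_upwards [key' i j hj] with k hk
    rw [h0]; exact hk
  have h2 : Tendsto (fun j : ℕ => r i + 1 / ((j : ℝ) + 1)) atTop (𝓝 (r i + 0)) :=
    tendsto_const_nhds.add tendsto_one_div_add_atTop_nhds_zero_nat
  rw [add_zero] at h2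
  exact ge_of_tendsto h2 (eventually_atTop.mpr ⟨i, h1⟩)

theorem lpK_sph (b : ℕ → lpK ε hpos hlim) (r : ℕ → ℝ)
    (h : ∀ i j, i ≤ j → ‖b i - b j‖ ≤ r i) : ∃ η, ∀ i, ‖η - b i‖ ≤ r i := by
  choose β hβ using fun i => lpPhi_surj (b i)
  obtain ⟨η, hη⟩ := lp_sph_aux β r (by
    intro i j hij
    have h2 := h i j hij
    rwa [← hβ, ← hβ, ← map_sub, lp_norm_phi] at h2)
  refine ⟨lpPhi ε hpos hlim η, fun i => ?_⟩
  rw [← norm_neg, neg_sub, ← hβ, ← map_sub, lp_norm_phi]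
  exact hη i

instance lpK_complete : CompleteSpace (lpK ε hpos hlim) := by
  apply Metric.complete_of_convergent_controlled_sequences (fun n => 1 / ((n : ℝ) + 1))
  · intro n; positivity
  · intro u hu
    obtain ⟨η, hη⟩ := lpK_sph u (fun n => 1 / ((n : ℝ) + 1)) (by
      intro i j hij
      rw [← dist_eq_norm]
      exact (hu i i j le_rfl hij).le)
    refine ⟨η, ?_⟩
    rw [tendsto_iff_norm_sub_tendsto_zero]
    refine squeeze_zero (fun _ => norm_nonneg _) (fun n => ?_)
      tendsto_one_div_add_atTop_nhds_zero_nat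
    rw [← norm_neg, neg_sub]
    exact hη n

instance lpK_algClosed : IsAlgClosed (lpK ε hpos hlim) := by
  apply IsAlgClosed.of_exists_root
  intro p hp hirr
  have hlift : p ∈ Polynomial.lifts (lpPhi ε hpos hlim) := by
    rw [Polynomial.mem_lifts]
    exact Polynomial.map_surjective _ lpPhi_surj p
  obtain ⟨P, hPp, hdeg, hmon⟩ := Polynomial.lifts_and_natDegree_eq_and_monic hlift hp
  have hd : 0 < P.natDegree := by rw [hdeg]; exact hirr.natDegree_pos
  let e : (k : ℕ) → lpMod ε hpos hlim →+* ℂ := fun k =>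
    (Pi.evalRingHom (fun _ => ℂ) k).comp (lpMod ε hpos hlim).subtype
  have hroot : ∀ k, ∃ z, (P.map (e k)).IsRoot z := fun k => by
    apply IsAlgClosed.exists_root
    rw [hmon.degree_map, Polynomial.degree_eq_natDegree hmon.ne_zero]
    exact_mod_cast hd.ne'
  choose z hz using hroot
  have hbd : ∀ k, ‖z k‖ ≤ 1 + ∑ i ∈ Finset.range P.natDegree, ‖(P.coeff i).1 k‖ := by
    intro k
    have hs : 0 ≤ ∑ i ∈ Finset.range P.natDegree, ‖(P.coeff i).1 k‖ :=
      Finset.sum_nonneg fun _ _ => norm_nonneg _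
    by_cases h1 : ‖z k‖ ≤ 1
    · linarith
    push Not at h1
    have h2 := hz k
    rw [Polynomial.IsRoot.def, Polynomial.eval_map, Polynomial.eval₂_eq_sum_range,
      Finset.sum_range_succ, hmon.coeff_natDegree, map_one, one_mul] at h2
    have h3 : ‖z k‖ ^ P.natDegree ≤
        (∑ i ∈ Finset.range P.natDegree, ‖(P.coeff i).1 k‖) * ‖z k‖ ^ (P.natDegree - 1) := by
      rw [← norm_pow, eq_neg_of_add_eq_zero_right h2, norm_neg, Finset.sum_mul]
      refine (norm_sum_le _ _).trans (Finset.sum_le_sum fun i hi => ?_)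
      rw [norm_mul, norm_pow]
      refine mul_le_mul_of_nonneg_left ?_ (norm_nonneg _)
      exact pow_le_pow_right₀ h1.le (Nat.le_sub_one_of_lt (Finset.mem_range.mp hi))
    have h4 : 0 < ‖z k‖ ^ (P.natDegree - 1) := by positivity
    have h5 : ‖z k‖ ^ P.natDegree = ‖z k‖ * ‖z k‖ ^ (P.natDegree - 1) := by
      rw [← pow_succ', Nat.sub_add_cancel hd]
    rw [h5] at h3
    have := le_of_mul_le_mul_right h3 h4
    linarith
  have hw : ∀ a : lpMod ε hpos hlim, lpModerate ε (fun k => ((‖a.1 k‖ : ℝ) : ℂ)) := fun a =>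
    lpModerate_of_le hpos (Eventually.of_forall fun k => by simp) a.2
  have hmod : lpModerate ε z := by
    refine lpModerate_of_le hpos (w := (1 + ∑ i ∈ Finset.range P.natDegree,
      (⟨_, hw (P.coeff i)⟩ : lpMod ε hpos hlim) : lpMod ε hpos hlim).1)
      (Eventually.of_forall fun k => ?_) (Subtype.prop (p := fun z => lpModerate ε z) _)
    refine (hbd k).trans (le_of_eq ?_)
    have : (1 + ∑ i ∈ Finset.range P.natDegree,
      (⟨_, hw (P.coeff i)⟩ : lpMod ε hpos hlim) : lpMod ε hpos hlim).1 k =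
      (((1 + ∑ i ∈ Finset.range P.natDegree, ‖(P.coeff i).1 k‖ : ℝ)) : ℂ) := by
      have he : ∀ x : lpMod ε hpos hlim, x.1 k = e k x := fun _ => rfl
      rw [he, map_add, map_one, map_sum]
      push_cast
      rfl
    rw [this, Complex.norm_real, Real.norm_of_nonneg]
    have hs : 0 ≤ ∑ i ∈ Finset.range P.natDegree, ‖(P.coeff i).1 k‖ :=
      Finset.sum_nonneg fun _ _ => norm_nonneg _
    linarith
  refine ⟨lpPhi ε hpos hlim ⟨z, hmod⟩, ?_⟩
  have h0 : P.eval ⟨z, hmod⟩ = 0 := by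
    apply Subtype.ext
    funext k
    have h1 := hz k
    rw [Polynomial.IsRoot.def, Polynomial.eval_map] at h1
    have h2 : e k (P.eval ⟨z, hmod⟩) = P.eval₂ (e k) (z k) :=
      (Polynomial.eval₂_at_apply (e k) (⟨z, hmod⟩ : lpMod ε hpos hlim)).symm
    change e k (P.eval ⟨z, hmod⟩) = 0
    rw [h2, h1]
  rw [← hPp, Polynomial.eval_map, Polynomial.eval₂_at_apply, h0, map_zero]

end
end

section
section
variable {ε : ℕ → ℝ} {hpos : ∀ k, 0 < ε k} {hlim : Tendsto ε atTop (𝓝 0)}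

theorem lp_const_tendsto (hpos : ∀ k, 0 < ε k) (hlim : Tendsto ε atTop (𝓝 0)) (r : ℂ)
    (hr : r ≠ 0) :
    Tendsto (fun k => ‖r‖ ^ ε k) (lpU : Filter ℕ) (𝓝 1) :=
  lp_two_rpow hlim _ (norm_pos_iff.mpr hr)

theorem lp_const_mod (hpos : ∀ k, 0 < ε k) (hlim : Tendsto ε atTop (𝓝 0)) (r : ℂ) :
    lpModerate ε (fun _ => r) := by
  by_cases hr : r = 0
  · subst hr
    exact ⟨0, Eventually.of_forall fun k => by simp [Real.zero_rpow (hpos k).ne']⟩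
  · exact ⟨2, ((lp_const_tendsto hpos hlim r hr).eventually_lt_const one_lt_two).mono
      fun k hk => le_of_lt hk⟩

variable (ε hpos hlim) in
def lpConst : ℂ →+* lpMod ε hpos hlim :=
  (Pi.constRingHom ℕ ℂ).codRestrict _ (fun r => lp_const_mod hpos hlim r)

theorem lpNu_const (r : ℂ) (hr : r ≠ 0) : lpNu (lpConst ε hpos hlim r) = 1 :=
  lpNu_eq (lp_const_tendsto hpos hlim r hr)

theorem lp_t_tendsto (hpos : ∀ k, 0 < ε k) (r : ℝ) (k : ℕ) :
    ‖((Real.exp (-r / ε k) : ℝ) : ℂ)‖ ^ ε k = Real.exp (-r) := by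
  rw [Complex.norm_real, Real.norm_of_nonneg (Real.exp_pos _).le, ← Real.exp_mul,
    div_mul_cancel₀ _ (hpos k).ne']

variable (ε hpos hlim) in
def lpT (r : ℝ) : lpMod ε hpos hlim :=
  ⟨fun k => ((Real.exp (-r / ε k) : ℝ) : ℂ), Real.exp (-r),
    Eventually.of_forall fun k => (lp_t_tendsto hpos r k).le⟩

theorem lpNu_t (r : ℝ) : lpNu (lpT ε hpos hlim r) = Real.exp (-r) := by
  apply lpNu_eq
  refine tendsto_const_nhds.congr fun k => ?_
  exact (lp_t_tendsto hpos r k).symm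

theorem lp_derivK (k0 : Subring (lpK ε hpos hlim)) (hk0 : ∀ z ∈ k0, z ≠ 0 → ‖z‖ = 1) :
    ∃ D : lpK ε hpos hlim → lpK ε hpos hlim,
      (∀ x y, D (x + y) = D x + D y) ∧ (∀ x y, D (x * y) = x * D y + y * D x) ∧
      (∀ z ∈ k0, D z = 0) ∧ (∀ z, ‖z‖ ≤ 1 → ‖D z‖ < 1) ∧
      (∀ z, ‖z‖ = Real.exp (-1) → ‖D z‖ = Real.exp (-1)) := by
  refine lp_derivation lpK_sph
    ((lpPhi ε hpos hlim).comp ((lpConst ε hpos hlim).comp Complex.ofRealHom)) ?_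
    (fun r => lpPhi ε hpos hlim (lpT ε hpos hlim r)) ?_ ?_ ?_ k0 hk0
  · intro r hr
    have h := lp_norm_phi (lpConst ε hpos hlim (r : ℂ))
    rw [lpNu_const _ (by exact_mod_cast hr)] at h
    exact h
  · rw [← map_one (lpPhi ε hpos hlim)]
    congr 1
    apply Subtype.ext
    funext k
    simp [lpT]
  · intro r s
    rw [← map_mul]
    congr 1
    apply Subtype.ext
    funext k
    change ((Real.exp (-(r + s) / ε k) : ℝ) : ℂ) =
      ((Real.exp (-r / ε k) : ℝ) : ℂ) * ((Real.exp (-s / ε k) : ℝ) : ℂ)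
    rw [← Complex.ofReal_mul, ← Real.exp_add]
    congr 2
    ring
  · intro r
    rw [lp_norm_phi, lpNu_t]
end
end

section
section
open scoped NNReal ENNReal

variable {X : Type*} [NormedAddCommGroup X] [NormedSpace ℝ X]

/-- the `k`-th Taylor coefficient in the last variable. -/
def lpC (p : FormalMultilinearSeries ℝ (X × ℝ) ℝ) (k : ℕ) (x : X) : ℝ :=
  p.changeOrigin (x, 0) k (fun _ => (0, 1))

theorem lp_summable_kl (p : FormalMultilinearSeries ℝ (X × ℝ) ℝ) {r r' : ℝ≥0}
    (hr : (r + r' : ℝ≥0∞) < p.radius) :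
    Summable (fun kl : ℕ × ℕ => ‖p.changeOriginSeries kl.1 kl.2‖ * (r : ℝ) ^ kl.2 * (r' : ℝ) ^ kl.1) := by
  have h1 := p.changeOriginSeries_summable_aux₁ hr
  have h2 : Summable fun s : Σ _ : ℕ, ℕ =>
      ‖p.changeOriginSeries s.1 s.2‖₊ * r ^ s.2 * r' ^ s.1 := by
    have e := (Equiv.sigmaAssoc (fun (k l : ℕ) => { s : Finset (Fin (k + l)) // s.card = l })).summable_iff.mpr h1
    refine NNReal.summable_of_le (fun s => ?_) (NNReal.summable_sigma.1 e).2
    have h3 := p.nnnorm_changeOriginSeries_le_tsum s.1 s.2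
    simp only [Function.comp_apply, Equiv.sigmaAssoc, Equiv.coe_fn_mk]
    rw [NNReal.tsum_mul_right, NNReal.tsum_mul_right]
    gcongr
  have h4 := (Equiv.sigmaEquivProd ℕ ℕ).symm.summable_iff.mpr h2
  have h5 := NNReal.summable_coe.mpr h4
  exact h5

variable {A : Type*} [NormedRing A] [NormedAlgebra ℝ A] [CompleteSpace A] [NormOneClass A]

def lpL (X : Type*) [NormedAddCommGroup X] [NormedSpace ℝ X] (S : A) (k : ℕ) :
    ((X × ℝ) [×k]→L[ℝ] ℝ) →L[ℝ] A :=
  (ContinuousMultilinearMap.apply ℝ (fun _ : Fin k => X × ℝ) ℝ (fun _ => ((0 : X), (1 : ℝ)))).smulRight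
    (S ^ k)

theorem lpL_apply (S : A) (k : ℕ) (v : (X × ℝ) [×k]→L[ℝ] ℝ) :
    lpL X S k v = v (fun _ => (0, 1)) • S ^ k := rfl

theorem lpL_norm (S : A) (k : ℕ) : ‖lpL X S k‖ ≤ ‖S‖ ^ k := by
  refine ContinuousLinearMap.opNorm_le_bound _ (by positivity) fun v => ?_
  rw [lpL_apply, norm_smul, mul_comm]
  refine mul_le_mul (norm_pow_le S k) ?_ (norm_nonneg _) (by positivity)
  refine (v.le_opNorm _).trans ?_
  simp

def lpTerm (p : FormalMultilinearSeries ℝ (X × ℝ) ℝ) (S : A) (k l : ℕ) : X [×l]→L[ℝ] A :=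
  (lpL X S k).compContinuousMultilinearMap
    ((p.changeOriginSeries k l).compContinuousLinearMap (fun _ => ContinuousLinearMap.inl ℝ X ℝ))

theorem lpTerm_apply (p : FormalMultilinearSeries ℝ (X × ℝ) ℝ) (S : A) (k l : ℕ) (x : X) :
    lpTerm p S k l (fun _ => x) = lpL X S k (p.changeOriginSeries k l (fun _ => (x, 0))) := rfl

theorem lpTerm_norm (p : FormalMultilinearSeries ℝ (X × ℝ) ℝ) (S : A) (k l : ℕ) :
    ‖lpTerm p S k l‖ ≤ ‖p.changeOriginSeries k l‖ * ‖S‖ ^ k := by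
  unfold lpTerm
  refine (ContinuousLinearMap.norm_compContinuousMultilinearMap_le _ _).trans ?_
  rw [mul_comm]
  refine mul_le_mul ?_ (lpL_norm S k) (norm_nonneg _) (ContinuousMultilinearMap.opNorm_nonneg _)
  refine (ContinuousMultilinearMap.norm_compContinuousLinearMap_le _ _).trans ?_
  have h : ‖ContinuousLinearMap.inl ℝ X ℝ‖ ≤ 1 := by
    refine ContinuousLinearMap.opNorm_le_bound _ zero_le_one fun v => ?_
    simp
  have h2 : ∏ _i : Fin l, ‖ContinuousLinearMap.inl ℝ X ℝ‖ ≤ 1 :=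
    Finset.prod_le_one (fun _ _ => norm_nonneg _) (fun _ _ => h)
  exact mul_le_of_le_one_right (ContinuousMultilinearMap.opNorm_nonneg _) h2

def lpHat (p : FormalMultilinearSeries ℝ (X × ℝ) ℝ) (S : A) (x : X) : A :=
  ∑' k, lpC p k x • S ^ k

theorem lp_double (T : (k l : ℕ) → X [×l]→L[ℝ] A) (c : ℕ → X → A) {r : ℝ≥0} (hr0 : 0 < r)
    (hsumT : Summable (fun kl : ℕ × ℕ => ‖T kl.1 kl.2‖ * (r : ℝ) ^ kl.2))
    (hrow : ∀ x : X, ‖x‖ < r → ∀ k, HasSum (fun l => T k l (fun _ => x)) (c k x)) :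
    HasFPowerSeriesOnBall (fun x => ∑' k, c k x) (fun l => ∑' k, T k l) 0 r ∧
    ∀ x : X, ‖x‖ < r → HasSum (fun k => c k x) (∑' k, c k x) := by
  have hsumT' : Summable (fun lk : ℕ × ℕ => ‖T lk.2 lk.1‖ * (r : ℝ) ^ lk.1) :=
    (Equiv.prodComm ℕ ℕ).summable_iff.mpr hsumT
  have hrl : ∀ l : ℕ, (r : ℝ) ^ l ≠ 0 := fun l => pow_ne_zero _ (by exact_mod_cast hr0.ne')
  have hTl : ∀ l, Summable fun k => ‖T k l‖ := fun l => by
    have h1 := hsumT'.prod_factor l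
    exact (summable_mul_right_iff (hrl l)).mp h1
  have hx : ∀ x : X, ‖x‖ < r → HasSum (fun k => c k x) (∑' k, c k x) ∧
      HasSum (fun l => (∑' k, T k l) (fun _ => x)) (∑' k, c k x) := by
    intro x hx
    have hb : ∀ k l, ‖T k l (fun _ => x)‖ ≤ ‖T k l‖ * (r : ℝ) ^ l := by
      intro k l
      refine ((T k l).le_opNorm _).trans ?_
      simp only [Finset.prod_const, Finset.card_univ, Fintype.card_fin]
      gcongr
    have hs : Summable (fun kl : ℕ × ℕ => T kl.1 kl.2 (fun _ => x)) :=
      Summable.of_norm_bounded hsumT fun kl => hb kl.1 kl.2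
    have hs' : Summable (fun lk : ℕ × ℕ => T lk.2 lk.1 (fun _ => x)) :=
      (Equiv.prodComm ℕ ℕ).summable_iff.mpr hs
    have hcol : ∀ l, HasSum (fun k => T k l (fun _ => x))
        ((∑' k, T k l) (fun _ => x)) := by
      intro l
      have h1 := (hTl l).of_norm.hasSum
      exact ContinuousMultilinearMap.hasSum_eval h1 _
    have hA := hs.hasSum.prod_fiberwise (hrow x hx)
    have hB := hs'.hasSum.prod_fiberwise hcol
    have hAB : ∑' kl : ℕ × ℕ, T kl.1 kl.2 (fun _ => x) =
        ∑' lk : ℕ × ℕ, T lk.2 lk.1 (fun _ => x) :=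
      ((Equiv.prodComm ℕ ℕ).tsum_eq (fun kl : ℕ × ℕ => T kl.1 kl.2 (fun _ => x))).symm
    have hval : ∑' k, c k x = ∑' kl : ℕ × ℕ, T kl.1 kl.2 (fun _ => x) := hA.tsum_eq
    rw [hval]
    exact ⟨hA, hAB ▸ hB⟩
  refine ⟨⟨?_, by exact_mod_cast hr0, ?_⟩, fun x h => (hx x h).1⟩
  · apply FormalMultilinearSeries.le_radius_of_summable
    refine Summable.of_nonneg_of_le (fun _ => by positivity) (fun l => ?_) hsumT'.prod
    dsimp only
    rw [tsum_mul_right]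
    exact mul_le_mul_of_nonneg_right (norm_tsum_le_tsum_norm (hTl l)) (by positivity)
  · intro y hy
    rw [zero_add]
    refine (hx y ?_).2
    rw [Metric.mem_eball, edist_zero_right, ← ofReal_norm] at hy
    have := (ENNReal.ofReal_lt_iff_lt_toReal (norm_nonneg _) (by simp)).mp hy
    simpa using this

theorem lpHat_main (p : FormalMultilinearSeries ℝ (X × ℝ) ℝ) {r r' : ℝ≥0}
    (hr : (r + r' : ℝ≥0∞) < p.radius) (hr0 : 0 < r) (S : A) (hS : ‖S‖ ≤ r') :
    HasFPowerSeriesOnBall (lpHat p S) (fun l => ∑' k, lpTerm p S k l) 0 r ∧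
    ∀ x : X, ‖x‖ < r → HasSum (fun k => lpC p k x • S ^ k) (lpHat p S x) := by
  have hsum := lp_summable_kl p hr
  have hT : ∀ k l, ‖lpTerm p S k l‖ * (r : ℝ) ^ l ≤
      ‖p.changeOriginSeries k l‖ * (r : ℝ) ^ l * (r' : ℝ) ^ k := by
    intro k l
    have h1 : ‖S‖ ^ k ≤ (r' : ℝ) ^ k := pow_le_pow_left₀ (norm_nonneg _) hS k
    have h0 : 0 ≤ ‖p.changeOriginSeries k l‖ := ContinuousMultilinearMap.opNorm_nonneg _
    have h3 : (0 : ℝ) ≤ (r : ℝ) ^ l := by positivity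
    have h4 := lpTerm_norm p S k l
    generalize ‖p.changeOriginSeries k l‖ = a at *
    calc ‖lpTerm p S k l‖ * (r : ℝ) ^ l ≤ (a * ‖S‖ ^ k) * (r : ℝ) ^ l :=
          mul_le_mul_of_nonneg_right h4 h3
      _ ≤ (a * (r' : ℝ) ^ k) * (r : ℝ) ^ l := by gcongr
      _ = _ := by ring
  have hsumT : Summable (fun kl : ℕ × ℕ => ‖lpTerm p S kl.1 kl.2‖ * (r : ℝ) ^ kl.2) :=
    Summable.of_nonneg_of_le (fun _ => by positivity) (fun kl => hT kl.1 kl.2) hsum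
  have hrad : (r : ℝ≥0∞) < p.radius := lt_of_le_of_lt le_self_add hr
  refine lp_double (lpTerm p S) (fun k x => lpC p k x • S ^ k) hr0 hsumT ?_
  intro x hx k
  have h1 := (p.hasFPowerSeriesOnBall_changeOrigin k (lt_of_le_of_lt bot_le hrad)).hasSum
    (y := ((x, 0) : X × ℝ)) (by
      rw [Metric.mem_eball, edist_zero_right]
      refine lt_of_le_of_lt ?_ hrad
      rw [← ofReal_norm, ENNReal.ofReal_le_iff_le_toReal (by simp)]
      simpa using hx.le)
  rw [zero_add] at h1
  exact (lpL X S k).hasSum h1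

theorem lpC_hasSum {f : X × ℝ → ℝ} {p : FormalMultilinearSeries ℝ (X × ℝ) ℝ} {R : ℝ≥0∞}
    (hf : HasFPowerSeriesOnBall f p 0 R) {r r' : ℝ≥0} (hr : (r + r' : ℝ≥0∞) < R)
    (x : X) (hx : ‖x‖ ≤ r) (t : ℝ) (ht : |t| ≤ r') :
    HasSum (fun k => lpC p k x * t ^ k) (f (x, t)) := by
  have hxe : ‖((x, 0) : X × ℝ)‖ₑ ≤ r := by
    rw [← ofReal_norm, ENNReal.ofReal_le_iff_le_toReal (by simp)]
    simpa using hx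
  have hte : ‖((0, t) : X × ℝ)‖ₑ ≤ r' := by
    rw [← ofReal_norm, ENNReal.ofReal_le_iff_le_toReal (by simp)]
    simpa using ht
  have h1 := (hf.changeOrigin (y := ((x, 0) : X × ℝ))
    (lt_of_le_of_lt hxe (lt_of_le_of_lt le_self_add hr))).hasSum (y := ((0, t) : X × ℝ)) (by
      rw [Metric.mem_eball, edist_zero_right, lt_tsub_iff_right, add_comm]
      exact lt_of_le_of_lt (add_le_add hxe hte) hr)
  have h2 : (0 + (x, 0) + (0, t) : X × ℝ) = (x, t) := by simp
  rw [h2] at h1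
  have h4 : (fun n => (p.changeOrigin (x, 0) n) fun _ => ((0, t) : X × ℝ)) =
      fun k => lpC p k x * t ^ k := by
    funext k
    have h3 : (fun _ : Fin k => ((0, t) : X × ℝ)) = fun _ => t • ((0, 1) : X × ℝ) := by
      funext _; simp
    rw [h3, ContinuousMultilinearMap.map_smul_univ]
    simp [lpC, mul_comm]
  rw [h4] at h1
  exact h1
end
end

section
section
open scoped NNReal ENNReal

theorem lp_isUnit_aux {A : Type*} [NormedRing A] [NormedAlgebra ℝ A] [CompleteSpace A]
    [NormOneClass A] {S L H : A} (hLS : L * S = 1) (hS : ‖S‖ ≤ 1) (c : ℕ → ℝ) (d : ℕ)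
    (hc : ∀ k < d, c k = 0) {ρ : ℝ} (hρ : 0 < ρ)
    (hs : Summable fun j => |c (d + (j + 1))| * ρ ^ (j + 1))
    (hlt : ∑' j, |c (d + (j + 1))| * ρ ^ (j + 1) < |c d|)
    (hH : HasSum (fun k => c k • (ρ • S) ^ k) H) : IsUnit (L ^ d * H) := by
  have hLSd : ∀ d j : ℕ, L ^ d * S ^ (d + j) = S ^ j := by
    intro d j
    induction d with
    | zero => simp
    | succ n ih =>
      rw [pow_succ, show n + 1 + j = (n + j) + 1 by ring, pow_succ' S, mul_assoc,
        ← mul_assoc L S, hLS, one_mul, ih]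
  have h1 : HasSum (fun j => c (d + j) • (ρ • S) ^ (d + j)) H := by
    have := (hasSum_nat_add_iff' d).mpr hH
    rw [Finset.sum_eq_zero (fun k hk => by rw [hc k (Finset.mem_range.mp hk), zero_smul]),
      sub_zero] at this
    have e : (fun n => c (n + d) • (ρ • S) ^ (n + d)) =
        fun j => c (d + j) • (ρ • S) ^ (d + j) := by
      funext j; rw [add_comm]
    rw [e] at this
    exact this
  have h2 : HasSum (fun j => (c (d + j) * ρ ^ (d + j)) • S ^ j) (L ^ d * H) := by
    have := h1.mul_left (L ^ d)
    have e : (fun j => L ^ d * c (d + j) • (ρ • S) ^ (d + j)) =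
        (fun j => (c (d + j) * ρ ^ (d + j)) • S ^ j) := by
      funext j
      rw [smul_pow, smul_smul, mul_smul_comm, hLSd]
    rw [e] at this
    exact this
  have h3 := (hasSum_nat_add_iff' 1).mpr h2
  rw [Finset.sum_range_one] at h3
  simp only [add_zero, pow_zero] at h3
  have hs' : Summable fun j => ρ ^ d * (|c (d + (j + 1))| * ρ ^ (j + 1)) := hs.mul_left _
  have h4 : ‖L ^ d * H - (c d * ρ ^ d) • (1 : A)‖ ≤
      ∑' j, ρ ^ d * (|c (d + (j + 1))| * ρ ^ (j + 1)) := by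
    rw [← h3.tsum_eq]
    refine tsum_of_norm_bounded hs'.hasSum fun j => ?_
    rw [norm_smul, Real.norm_eq_abs, abs_mul, abs_of_nonneg (by positivity : 0 ≤ ρ ^ (d + (j + 1))),
      pow_add]
    have h5 : ‖S ^ (j + 1)‖ ≤ 1 :=
      (norm_pow_le _ _).trans (pow_le_one₀ (norm_nonneg _) hS)
    calc _ ≤ |c (d + (j + 1))| * (ρ ^ d * ρ ^ (j + 1)) * 1 := by gcongr
      _ = _ := by ring
  rw [tsum_mul_left] at h4
  set a : ℝ := c d * ρ ^ d with ha
  have hcd : 0 < |c d| := lt_of_le_of_lt (tsum_nonneg fun j => by positivity) hlt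
  have ha0 : a ≠ 0 := mul_ne_zero (abs_pos.mp hcd) (by positivity)
  have h5 : ‖L ^ d * H - a • (1 : A)‖ < |a| := by
    refine h4.trans_lt ?_
    rw [ha, abs_mul, abs_of_pos (by positivity : 0 < ρ ^ d), mul_comm |c d|]
    exact mul_lt_mul_of_pos_left hlt (by positivity)
  have h6 : ‖1 - a⁻¹ • (L ^ d * H)‖ < 1 := by
    have : 1 - a⁻¹ • (L ^ d * H) = -(a⁻¹ • (L ^ d * H - a • (1 : A))) := by
      rw [smul_sub, smul_smul, inv_mul_cancel₀ ha0, one_smul, neg_sub]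
    rw [this, norm_neg, norm_smul, norm_inv, Real.norm_eq_abs, inv_mul_lt_one₀ (abs_pos.mpr ha0)]
    exact h5
  have h7 := isUnit_one_sub_of_norm_lt_one h6
  rw [sub_sub_cancel] at h7
  have h8 : L ^ d * H = a • (a⁻¹ • (L ^ d * H)) := by
    rw [smul_smul, mul_inv_cancel₀ ha0, one_smul]
  rw [h8, Algebra.smul_def]
  exact ((IsUnit.mk0 a ha0).map (algebraMap ℝ A)).mul h7

theorem lp_shift_data : ∃ (S L : (BoundedContinuousFunction ℕ ℝ) →L[ℝ] (BoundedContinuousFunction ℕ ℝ))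
    (e : BoundedContinuousFunction ℕ ℝ) (δ : (BoundedContinuousFunction ℕ ℝ) →L[ℝ] ℝ),
    ‖S‖ ≤ 1 ∧ ‖L‖ ≤ 1 ∧ L * S = 1 ∧ (∀ b, δ (S b) = 0) ∧ L e = 0 ∧ δ e = 1 := by
  let sf : (BoundedContinuousFunction ℕ ℝ) → ℕ → ℝ := fun b n => if n = 0 then 0 else b (n - 1)
  have hsf : ∀ b n, ‖sf b n‖ ≤ ‖b‖ := by
    intro b n
    simp only [sf]
    split_ifs
    · simp
    · exact b.norm_coe_le_norm _
  let S0 : (BoundedContinuousFunction ℕ ℝ) →ₗ[ℝ] (BoundedContinuousFunction ℕ ℝ) :=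
    { toFun := fun b => BoundedContinuousFunction.ofNormedAddCommGroupDiscrete (sf b) ‖b‖ (hsf b)
      map_add' := by
        intro b b'
        ext n
        simp only [sf, BoundedContinuousFunction.coe_ofNormedAddCommGroupDiscrete,
          BoundedContinuousFunction.coe_add, Pi.add_apply]
        split_ifs <;> simp
      map_smul' := by
        intro c b
        ext n
        simp [sf] }
  let L0 : (BoundedContinuousFunction ℕ ℝ) →ₗ[ℝ] (BoundedContinuousFunction ℕ ℝ) :=
    { toFun := fun b => BoundedContinuousFunction.ofNormedAddCommGroupDiscrete
        (fun n => b (n + 1)) ‖b‖ (fun n => b.norm_coe_le_norm _)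
      map_add' := by
        intro b b'
        ext n
        simp
      map_smul' := by
        intro c b
        ext n
        simp }
  have hS : ∀ b, ‖S0 b‖ ≤ 1 * ‖b‖ := fun b => by
    rw [one_mul]
    exact (BoundedContinuousFunction.norm_le (norm_nonneg _)).mpr (hsf b)
  have hL : ∀ b, ‖L0 b‖ ≤ 1 * ‖b‖ := fun b => by
    rw [one_mul]
    exact (BoundedContinuousFunction.norm_le (norm_nonneg _)).mpr fun n => b.norm_coe_le_norm _
  refine ⟨S0.mkContinuous 1 hS, L0.mkContinuous 1 hL,
    BoundedContinuousFunction.ofNormedAddCommGroupDiscrete (fun n => if n = 0 then 1 else 0) 1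
      (fun n => by split_ifs <;> simp), BoundedContinuousFunction.evalCLM ℝ 0,
    LinearMap.mkContinuous_norm_le _ zero_le_one _, LinearMap.mkContinuous_norm_le _ zero_le_one _,
    ?_, ?_, ?_, ?_⟩
  · ext b n
    simp [L0, S0, sf]
  · intro b
    simp [S0, sf]
  · ext n
    simp [L0]
  · simp
end
end

section
section
open scoped NNReal ENNReal

variable {B : Type*} [NormedAddCommGroup B] [NormedSpace ℝ B] [CompleteSpace B]

def lpEv (L : B →L[ℝ] B) (δ : B →L[ℝ] ℝ) (s : ℝ) : B →L[ℝ] ℝ :=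
  δ.comp (Ring.inverse (1 - s • L))

theorem lpEv_unit {L : B →L[ℝ] B} (hL : ‖L‖ ≤ 1) {s : ℝ} (hs : |s| < 1) :
    IsUnit (1 - s • L) := by
  apply isUnit_one_sub_of_norm_lt_one
  rw [norm_smul, Real.norm_eq_abs]
  have := norm_nonneg L
  have := abs_nonneg s
  nlinarith

theorem lpEv_step {L : B →L[ℝ] B} {δ : B →L[ℝ] ℝ} (hL : ‖L‖ ≤ 1) {s : ℝ} (hs : |s| < 1) (b : B) :
    lpEv L δ s b = δ b + s * lpEv L δ s (L b) := by
  have h1 := Ring.inverse_mul_cancel _ (lpEv_unit hL hs)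
  have h2 : Ring.inverse (1 - s • L) b = b + s • Ring.inverse (1 - s • L) (L b) := by
    have h3 : Ring.inverse (1 - s • L) ((1 - s • L) b) = b :=
      congrArg (fun M : B →L[ℝ] B => M b) h1
    have h4 : (1 - s • L) b = b - s • L b := rfl
    rw [h4, map_sub, map_smul] at h3
    rw [sub_eq_iff_eq_add] at h3
    exact h3
  change δ (Ring.inverse (1 - s • L) b) = δ b + s * δ (Ring.inverse (1 - s • L) (L b))
  rw [h2, map_add, map_smul, smul_eq_mul]

theorem lpEv_S {S L : B →L[ℝ] B} {δ : B →L[ℝ] ℝ} (hL : ‖L‖ ≤ 1) (hLS : L * S = 1)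
    (hδS : ∀ b, δ (S b) = 0) {s : ℝ} (hs : |s| < 1) (b : B) :
    lpEv L δ s (S b) = s * lpEv L δ s b := by
  have h1 : L (S b) = b := congrArg (fun M : B →L[ℝ] B => M b) hLS
  rw [lpEv_step hL hs, hδS, h1, zero_add]

theorem lpEv_Spow {S L : B →L[ℝ] B} {δ : B →L[ℝ] ℝ} (hL : ‖L‖ ≤ 1) (hLS : L * S = 1)
    (hδS : ∀ b, δ (S b) = 0) {s : ℝ} (hs : |s| < 1) (k : ℕ) (b : B) :
    lpEv L δ s ((S ^ k) b) = s ^ k * lpEv L δ s b := by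
  induction k with
  | zero => simp
  | succ n ih =>
    have h1 : (S ^ (n + 1)) b = S ((S ^ n) b) := by rw [pow_succ']; rfl
    rw [h1, lpEv_S hL hLS hδS hs, ih, pow_succ']; ring

theorem lpEv_e {L : B →L[ℝ] B} {δ : B →L[ℝ] ℝ} {e : B} (hL : ‖L‖ ≤ 1) (hLe : L e = 0)
    (hδe : δ e = 1) {s : ℝ} (hs : |s| < 1) : lpEv L δ s e = 1 := by
  rw [lpEv_step hL hs, hLe, map_zero, mul_zero, add_zero, hδe]

theorem lpEv_sum {L : B →L[ℝ] B} {δ : B →L[ℝ] ℝ} (hL : ‖L‖ ≤ 1) {s : ℝ} (hs : |s| < 1)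
    (d : ℕ) (b : B) :
    lpEv L δ s b = ∑ j ∈ Finset.range d, s ^ j * δ ((L ^ j) b) + s ^ d * lpEv L δ s ((L ^ d) b) := by
  induction d with
  | zero => simp
  | succ n ih =>
    have h1 : (L ^ (n + 1)) b = L ((L ^ n) b) := by rw [pow_succ']; rfl
    rw [Finset.sum_range_succ, h1, ih, lpEv_step hL hs ((L ^ n) b)]
    ring

theorem lpEv_hat {S L H : B →L[ℝ] B} {δ : B →L[ℝ] ℝ} (hL : ‖L‖ ≤ 1) (hLS : L * S = 1)
    (hδS : ∀ b, δ (S b) = 0) {s : ℝ} (hs : |s| < 1) (c : ℕ → ℝ) (ρ v : ℝ)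
    (hH : HasSum (fun k => c k • (ρ • S) ^ k) H)
    (hv : HasSum (fun k => c k * (ρ * s) ^ k) v) (b : B) :
    lpEv L δ s (H b) = v * lpEv L δ s b := by
  have h1 := ((lpEv L δ s).comp (ContinuousLinearMap.apply ℝ B b)).hasSum hH
  have h2 := hv.mul_right (lpEv L δ s b)
  have h3 : (fun k => ((lpEv L δ s).comp (ContinuousLinearMap.apply ℝ B b)) (c k • (ρ • S) ^ k)) =
      fun k => c k * (ρ * s) ^ k * lpEv L δ s b := by
    funext k
    change lpEv L δ s ((c k • (ρ • S) ^ k) b) = _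
    rw [smul_pow, ContinuousLinearMap.smul_apply, ContinuousLinearMap.smul_apply, map_smul, map_smul,
      lpEv_Spow hL hLS hδS hs, mul_pow, smul_eq_mul, smul_eq_mul]
    ring
  rw [h3] at h1
  exact h1.unique h2

theorem lp_choose_rho (c : ℕ → ℝ) (d : ℕ) (hd : c d ≠ 0) {ρ₀ : ℝ} (hρ₀ : 0 < ρ₀)
    (hs : Summable fun k => |c k| * ρ₀ ^ k) :
    ∃ ρ, 0 < ρ ∧ ρ ≤ ρ₀ ∧ Summable (fun j => |c (d + (j + 1))| * ρ ^ (j + 1)) ∧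
      ∑' j, |c (d + (j + 1))| * ρ ^ (j + 1) < |c d| := by
  have h1 : Summable fun j => |c (d + (j + 1))| * ρ₀ ^ (j + 1) := by
    have h2 := (summable_nat_add_iff (d + 1)).mpr hs
    have h3 := h2.mul_left ((ρ₀ ^ d)⁻¹)
    refine h3.congr fun j => ?_
    rw [show j + (d + 1) = d + (j + 1) by ring, pow_add]
    field_simp
  set M := ∑' j, |c (d + (j + 1))| * ρ₀ ^ (j + 1) with hM
  have hM0 : 0 ≤ M := tsum_nonneg fun j => by positivity
  have hcd : 0 < |c d| := abs_pos.mpr hd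
  set κ := min 1 (|c d| / (2 * (M + 1))) with hκ
  have hκ0 : 0 < κ := lt_min one_pos (by positivity)
  have hκ1 : κ ≤ 1 := min_le_left _ _
  have hle : ∀ j, |c (d + (j + 1))| * (κ * ρ₀) ^ (j + 1) ≤
      κ * (|c (d + (j + 1))| * ρ₀ ^ (j + 1)) := by
    intro j
    rw [mul_pow]
    have : κ ^ (j + 1) ≤ κ := by
      rw [pow_succ]
      exact mul_le_of_le_one_left hκ0.le (pow_le_one₀ hκ0.le hκ1)
    calc _ = κ ^ (j + 1) * (|c (d + (j + 1))| * ρ₀ ^ (j + 1)) := by ring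
      _ ≤ _ := by gcongr
  have hsum : Summable (fun j => |c (d + (j + 1))| * (κ * ρ₀) ^ (j + 1)) :=
    Summable.of_nonneg_of_le (fun j => by positivity) hle (h1.mul_left κ)
  refine ⟨κ * ρ₀, by positivity, mul_le_of_le_one_left hρ₀.le hκ1, hsum, ?_⟩
  have h4 := hsum.tsum_le_tsum hle (h1.mul_left κ)
  rw [tsum_mul_left, ← hM] at h4
  refine h4.trans_lt ?_
  have h5 : κ ≤ |c d| / (2 * (M + 1)) := min_le_right _ _
  rw [le_div_iff₀ (by positivity)] at h5
  nlinarith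

end
end

section
section
open scoped NNReal ENNReal

theorem lp_clm_apply {X : Type*} [NormedAddCommGroup X] [NormedSpace ℝ X]
    {B : Type*} [NormedAddCommGroup B] [NormedSpace ℝ B]
    {M : X → B →L[ℝ] B} {b : X → B} {x : X} (hM : AnalyticAt ℝ M x) (hb : AnalyticAt ℝ b x) :
    AnalyticAt ℝ (fun y => M y (b y)) x :=
  AnalyticAt.comp (g := fun z : (B →L[ℝ] B) × B => z.1 z.2) (f := fun y => (M y, b y))
    (ContinuousLinearMap.analyticAt_bilinear (ContinuousLinearMap.id ℝ (B →L[ℝ] B)) (M x, b x))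
    (hM.prod hb)

theorem lp_division_aux {X : Type*} [NormedAddCommGroup X] [NormedSpace ℝ X]
    {B : Type*} [NormedAddCommGroup B] [NormedSpace ℝ B] [CompleteSpace B]
    {S L : B →L[ℝ] B} {e : B} {δ : B →L[ℝ] ℝ}
    (hS : ‖S‖ ≤ 1) (hL : ‖L‖ ≤ 1) (hLS : L * S = 1) (hδS : ∀ b, δ (S b) = 0) (hLe : L e = 0)
    (hδe : δ e = 1)
    {h g : X × ℝ → ℝ} (hh : AnalyticAt ℝ h 0) (hg : AnalyticAt ℝ g 0)
    (hne : ¬ ∀ᶠ t : ℝ in 𝓝 0, h (0, t) = 0) :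
    ∃ (d : ℕ) (q : X × ℝ → ℝ) (r : ℕ → X → ℝ), AnalyticAt ℝ q 0 ∧ (∀ j, AnalyticAt ℝ (r j) 0) ∧
      ∀ᶠ z in 𝓝 (0 : X × ℝ), g z = q z * h z + ∑ j ∈ Finset.range d, r j z.1 * z.2 ^ j := by
  classical
  obtain ⟨ph, Rh, hph⟩ := hh
  obtain ⟨pg, Rg, hpg⟩ := hg
  obtain ⟨ρ₀, hρ₀, hρh, hρg⟩ : ∃ ρ₀ : ℝ≥0, 0 < ρ₀ ∧ (ρ₀ + ρ₀ : ℝ≥0∞) < Rh ∧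
      (ρ₀ + ρ₀ : ℝ≥0∞) < Rg := by
    obtain ⟨a, ha0, ha⟩ := ENNReal.lt_iff_exists_nnreal_btwn.mp (lt_min hph.r_pos hpg.r_pos)
    have ha0' : 0 < a := by exact_mod_cast ha0
    have h2 : ((a / 2 : ℝ≥0) + (a / 2 : ℝ≥0) : ℝ≥0∞) = a := by
      rw [← ENNReal.coe_add, add_halves]
    refine ⟨a / 2, by positivity, ?_, ?_⟩
    · rw [h2]; exact ha.trans_le (min_le_left _ _)
    · rw [h2]; exact ha.trans_le (min_le_right _ _)
  have hρ₀' : (0 : ℝ) < ρ₀ := by exact_mod_cast hρ₀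
  have hex : ∃ k, lpC ph k 0 ≠ 0 := by
    by_contra hcon
    push Not at hcon
    apply hne
    have h1 : ∀ᶠ t : ℝ in 𝓝 0, |t| < ρ₀ := by
      have : Tendsto (fun t : ℝ => |t|) (𝓝 0) (𝓝 |0|) := continuous_abs.tendsto 0
      rw [abs_zero] at this
      exact this.eventually_lt_const hρ₀'
    filter_upwards [h1] with t ht
    have h2 := lpC_hasSum hph hρh (0 : X) (by simp) t ht.le
    simp only [hcon, zero_mul] at h2
    exact h2.unique hasSum_zero
  set d := Nat.find hex with hd
  have hcd : lpC ph d 0 ≠ 0 := Nat.find_spec hex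
  have hcl : ∀ k < d, lpC ph k 0 = 0 := fun k hk => not_not.mp (Nat.find_min hex hk)
  have hsum : Summable fun k => |lpC ph k 0| * (ρ₀ : ℝ) ^ k := by
    have h2 := (lpC_hasSum hph hρh (0 : X) (by simp) ρ₀ (abs_of_pos hρ₀').le).summable.abs
    refine h2.congr fun k => ?_
    rw [abs_mul, abs_of_pos (pow_pos hρ₀' k)]
  obtain ⟨ρ, hρ, hρle, hs, hlt⟩ := lp_choose_rho (fun k => lpC ph k 0) d hcd hρ₀' hsum
  have hnt : Nontrivial (B) := ⟨e, 0, fun h => by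
    rw [h, map_zero] at hδe; exact zero_ne_one hδe⟩
  have hSn : ‖ρ • S‖ ≤ ρ₀ := by
    rw [norm_smul, Real.norm_of_nonneg hρ.le]
    have := norm_nonneg S
    nlinarith
  obtain ⟨hHan, hHsum⟩ := lpHat_main ph (hρh.trans_le hph.r_le) hρ₀ (ρ • S) hSn
  obtain ⟨hGan, hGsum⟩ := lpHat_main pg (hρg.trans_le hpg.r_le) hρ₀ (ρ • S) hSn
  replace hHan : AnalyticAt ℝ (lpHat ph (ρ • S)) 0 := hHan.analyticAt
  replace hGan : AnalyticAt ℝ (lpHat pg (ρ • S)) 0 := hGan.analyticAt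
  set H := lpHat ph (ρ • S) with hHdef
  set G := lpHat pg (ρ • S) with hGdef
  have hunit0 : IsUnit (L ^ d * H 0) :=
    lp_isUnit_aux hLS hS (fun k => lpC ph k 0) d hcl hρ hs hlt (hHsum 0 (by simpa using hρ₀'))
  have hLHan : AnalyticAt ℝ (fun x => L ^ d * H x) 0 := analyticAt_const.mul hHan
  have hinv : AnalyticAt ℝ (fun x => Ring.inverse (L ^ d * H x)) 0 := by
    obtain ⟨u, hu⟩ := hunit0
    have h1 : AnalyticAt ℝ Ring.inverse ((fun x => L ^ d * H x) 0) := by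
      change AnalyticAt ℝ Ring.inverse (L ^ d * H 0)
      rw [← hu]; exact analyticAt_inverse u
    exact AnalyticAt.comp (f := fun x => L ^ d * H x) h1 hLHan
  have hGe : AnalyticAt ℝ (fun x => G x e) 0 := lp_clm_apply hGan analyticAt_const
  have hLGe : AnalyticAt ℝ (fun x => (L ^ d) (G x e)) 0 :=
    (ContinuousLinearMap.analyticAt (L ^ d) _).comp hGe
  let q : X → B := fun x => Ring.inverse (L ^ d * H x) ((L ^ d) (G x e))
  have hq : AnalyticAt ℝ q 0 := lp_clm_apply hinv hLGe
  let r : X → B := fun x => G x e - H x (q x)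
  have hr : AnalyticAt ℝ r 0 := hGe.sub (lp_clm_apply hHan hq)
  have hunit : ∀ᶠ x in 𝓝 (0 : X), IsUnit (L ^ d * H x) := by
    have h1 : Tendsto (fun x => L ^ d * H x) (𝓝 0) (𝓝 (L ^ d * H 0)) := hLHan.continuousAt
    exact h1.eventually (Units.isOpen.mem_nhds hunit0)
  have hfst : Tendsto (fun z : X × ℝ => z.1) (𝓝 0) (𝓝 0) := continuous_fst.tendsto 0
  have hsnd : Tendsto (fun z : X × ℝ => z.2) (𝓝 0) (𝓝 0) := continuous_snd.tendsto 0
  have hfan : AnalyticAt ℝ (fun z : X × ℝ => z.1) 0 := analyticAt_fst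
  have hsan : AnalyticAt ℝ (fun z : X × ℝ => z.2) 0 := analyticAt_snd
  have hevan : AnalyticAt ℝ (fun z : X × ℝ => Ring.inverse (1 - (ρ⁻¹ * z.2) • L)) 0 := by
    have h1 : AnalyticAt ℝ (fun z : X × ℝ => 1 - (ρ⁻¹ * z.2) • L) 0 :=
      analyticAt_const.sub ((analyticAt_const.mul hsan).smul analyticAt_const)
    have h2 : AnalyticAt ℝ Ring.inverse ((fun z : X × ℝ => 1 - (ρ⁻¹ * z.2) • L) 0) := by
      simp only [Prod.snd_zero, mul_zero, zero_smul, sub_zero]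
      exact analyticAt_inverse 1
    exact AnalyticAt.comp (f := fun z : X × ℝ => 1 - (ρ⁻¹ * z.2) • L) h2 h1
  refine ⟨d, fun z => lpEv L δ (ρ⁻¹ * z.2) (q z.1), fun j x => (ρ⁻¹) ^ j * δ ((L ^ j) (r x)),
    ?_, ?_, ?_⟩
  · have h1 : AnalyticAt ℝ (fun z : X × ℝ => q z.1) 0 := AnalyticAt.comp (g := q) hq hfan
    exact (ContinuousLinearMap.analyticAt δ _).comp (lp_clm_apply hevan h1)
  · intro j
    refine analyticAt_const.mul ?_
    exact (ContinuousLinearMap.analyticAt (δ.comp (L ^ j)) _).comp hr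
  · have e1 : ∀ᶠ z : X × ℝ in 𝓝 0, ‖z.1‖ < ρ₀ := by
      have : Tendsto (fun z : X × ℝ => ‖z.1‖) (𝓝 0) (𝓝 0) := by
        simpa using hfst.norm
      exact this.eventually_lt_const hρ₀'
    have e2 : ∀ᶠ z : X × ℝ in 𝓝 0, |z.2| < ρ := by
      have : Tendsto (fun z : X × ℝ => |z.2|) (𝓝 0) (𝓝 0) := by
        simpa using hsnd.abs
      exact this.eventually_lt_const hρ
    filter_upwards [e1, e2, hfst.eventually hunit] with z hz1 hz2 hu
    obtain ⟨x, t⟩ := z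
    dsimp only at *
    have hst : |ρ⁻¹ * t| < 1 := by
      rw [abs_mul, abs_of_pos (inv_pos.mpr hρ), inv_mul_lt_one₀ hρ]; exact hz2
    have hρs : ρ * (ρ⁻¹ * t) = t := by rw [← mul_assoc, mul_inv_cancel₀ hρ.ne', one_mul]
    have hgz := lpEv_hat hL hLS hδS hst (fun k => lpC pg k x) ρ (g (x, t)) (hGsum x hz1)
      (by rw [hρs]; exact lpC_hasSum hpg hρg x hz1.le t (hz2.le.trans hρle)) e
    have hhz := lpEv_hat hL hLS hδS hst (fun k => lpC ph k x) ρ (h (x, t)) (hHsum x hz1)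
      (by rw [hρs]; exact lpC_hasSum hph hρh x hz1.le t (hz2.le.trans hρle)) (q x)
    rw [lpEv_e hL hLe hδe hst, mul_one] at hgz
    have hLr : (L ^ d) (r x) = 0 := by
      have h1 : (L ^ d * H x) (q x) = (L ^ d) (G x e) :=
        congrArg (fun M : B →L[ℝ] B =>
          M ((L ^ d) (G x e))) (Ring.mul_inverse_cancel _ hu)
      change (L ^ d) (G x e - H x (q x)) = 0
      rw [map_sub, ← h1]
      exact sub_self _
    have hrs := lpEv_sum (δ := δ) hL hst d (r x)
    rw [hLr, map_zero, mul_zero, add_zero] at hrs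
    have hsplit : G x e = H x (q x) + r x := by simp [r]
    rw [← hgz, ← hGdef, hsplit, map_add, ← hHdef] at *
    rw [hhz, hrs, mul_comm]
    congr 1
    refine Finset.sum_congr rfl fun j _ => ?_
    rw [mul_pow]; ring

theorem lp_division {X : Type*} [NormedAddCommGroup X] [NormedSpace ℝ X]
    {h g : X × ℝ → ℝ} (hh : AnalyticAt ℝ h 0) (hg : AnalyticAt ℝ g 0)
    (hne : ¬ ∀ᶠ t : ℝ in 𝓝 0, h (0, t) = 0) :
    ∃ (d : ℕ) (q : X × ℝ → ℝ) (r : ℕ → X → ℝ), AnalyticAt ℝ q 0 ∧ (∀ j, AnalyticAt ℝ (r j) 0) ∧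
      ∀ᶠ z in 𝓝 (0 : X × ℝ), g z = q z * h z + ∑ j ∈ Finset.range d, r j z.1 * z.2 ^ j := by
  obtain ⟨S, L, e, δ, hS, hL, hLS, hδS, hLe, hδe⟩ := lp_shift_data
  exact lp_division_aux hS hL hLS hδS hLe hδe hh hg hne
end
end

section
section
variable {E : Type*} [NormedAddCommGroup E] [NormedSpace ℝ E]

/-- Functions on `E` analytic at `0`. -/
def lpAn (E : Type*) [NormedAddCommGroup E] [NormedSpace ℝ E] : Subring (E → ℝ) where
  carrier := {F | AnalyticAt ℝ F 0}
  mul_mem' ha hb := AnalyticAt.mul ha hb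
  one_mem' := (analyticAt_const : AnalyticAt ℝ (fun _ : E => (1 : ℝ)) 0)
  add_mem' ha hb := AnalyticAt.add ha hb
  zero_mem' := (analyticAt_const : AnalyticAt ℝ (fun _ : E => (0 : ℝ)) 0)
  neg_mem' ha := AnalyticAt.neg ha

theorem lpAn_comp {g : E → ℝ} (hg : AnalyticAt ℝ g 0) (P : E →L[ℝ] E) :
    AnalyticAt ℝ (fun x => g (P x)) 0 := by
  refine AnalyticAt.comp (g := g) (f := P) ?_ (P.analyticAt 0)
  rw [map_zero]; exact hg

/-- pull back by a linear endomorphism -/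
def lpPull (P : E →L[ℝ] E) : lpAn E →+* lpAn E where
  toFun F := ⟨fun x => F.1 (P x), lpAn_comp F.2 P⟩
  map_one' := rfl
  map_mul' _ _ := rfl
  map_zero' := rfl
  map_add' _ _ := rfl

/-- linear functional -/
def lpLin (l : E →L[ℝ] ℝ) : lpAn E := ⟨l, l.analyticAt 0⟩

def lpCst (E : Type*) [NormedAddCommGroup E] [NormedSpace ℝ E] (c : ℝ) : lpAn E :=
  ⟨fun _ => c, analyticAt_const⟩

/-- directional derivative -/
def lpPar (v : E) (F : lpAn E) : lpAn E :=
  ⟨fun x => fderiv ℝ F.1 x v, AnalyticAt.comp (g := ContinuousLinearMap.apply ℝ ℝ v)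
    (ContinuousLinearMap.analyticAt _ _) (AnalyticAt.fderiv F.2)⟩

variable {K : Type*} [NormedField K] [IsUltrametricDist K]

/-- bounded derivation over `φ` respecting germs -/
structure LpDer (φ : lpAn E →+* K) (Δ : lpAn E → K) : Prop where
  add : ∀ F G, Δ (F + G) = Δ F + Δ G
  leib : ∀ F G, Δ (F * G) = φ F * Δ G + φ G * Δ F
  bdd : ∀ F, ‖Δ F‖ ≤ 1
  germ : ∀ F G : lpAn E, (∀ᶠ x in 𝓝 (0 : E), F.1 x = G.1 x) → Δ F = Δ G

/-- kernel subring -/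
def lpKer {φ : lpAn E →+* K} {Δ : lpAn E → K} (h : LpDer φ Δ) : Subring (lpAn E) where
  carrier := {F | Δ F = 0}
  mul_mem' {a b} ha hb := by
    change Δ (a * b) = 0
    rw [h.leib, show Δ a = 0 from ha, show Δ b = 0 from hb]; simp
  one_mem' := by
    have h1 := h.leib 1 1
    simp only [mul_one, map_one, one_mul] at h1
    exact left_eq_add.mp h1
  add_mem' {a b} ha hb := by
    change Δ (a + b) = 0
    rw [h.add, show Δ a = 0 from ha, show Δ b = 0 from hb]; simp
  zero_mem' := by
    have h1 := h.add 0 0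
    rw [add_zero] at h1
    exact left_eq_add.mp h1
  neg_mem' {a} ha := by
    have h0 : Δ 0 = 0 := by
      have h1 := h.add 0 0
      rw [add_zero] at h1
      exact left_eq_add.mp h1
    have h1 := h.add a (-a)
    rw [add_neg_cancel, h0, show Δ a = 0 from ha, zero_add] at h1
    exact h1.symm

theorem LpDer.pow_bound {φ : lpAn E →+* K} {Δ : lpAn E → K} (h : LpDer φ Δ)
    (hφ : ∀ F, ‖φ F‖ ≤ 1) {H : lpAn E} (Q : lpAn E) (N : ℕ) :
    ‖Δ (Q * H ^ (N + 1))‖ ≤ ‖φ H‖ ^ N := by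
  induction N with
  | zero => simpa using h.bdd _
  | succ N ih =>
    rw [pow_succ, ← mul_assoc, h.leib]
    refine (IsUltrametricDist.norm_add_le_max _ _).trans (max_le ?_ ?_)
    · rw [norm_mul, map_mul, map_pow, norm_mul, norm_pow]
      have h1 := hφ Q
      have h2 := h.bdd H
      calc ‖φ Q‖ * ‖φ H‖ ^ (N + 1) * ‖Δ H‖ ≤ 1 * ‖φ H‖ ^ (N + 1) * 1 := by gcongr
        _ = _ := by ring
    · rw [norm_mul, pow_succ' ‖φ H‖]
      exact mul_le_mul_of_nonneg_left ih (norm_nonneg _)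

/-- A bounded derivation killing pullbacks by `P` and linear functionals is zero. -/
def LpRigid (φ : lpAn E →+* K) (P : E →L[ℝ] E) : Prop :=
  ∀ Δ : lpAn E → K, LpDer φ Δ → (∀ l, Δ (lpLin l) = 0) → (∀ g, Δ (lpPull P g) = 0) → ∀ F, Δ F = 0

theorem lpRigid_id (φ : lpAn E →+* K) : LpRigid φ (ContinuousLinearMap.id ℝ E) :=
  fun _ _ _ h F => h F

theorem lpRigid_step {φ : lpAn E →+* K} (hφ : ∀ F, ‖φ F‖ ≤ 1) {P : E →L[ℝ] E} (hP : LpRigid φ P)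
    (h : lpAn E) (hh : ‖φ (lpPull P h)‖ < 1) (w : E) (hw : ¬ ∀ᶠ t : ℝ in 𝓝 0, h.1 (t • w) = 0)
    (l : E →L[ℝ] ℝ) :
    LpRigid φ (P - (l.comp P).smulRight w) := by
  intro Δ hΔ hlin hpull
  apply hP Δ hΔ hlin
  intro g
  have key : ∀ N : ℕ, ‖Δ (lpPull P g)‖ ≤ ‖φ (lpPull P h)‖ ^ N := by
    intro N
    let A : E × ℝ →L[ℝ] E := ContinuousLinearMap.fst ℝ E ℝ +
      (ContinuousLinearMap.snd ℝ E ℝ).smulRight w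
    have hA : ∀ z, A z = z.1 + z.2 • w := fun z => rfl
    have an : ∀ F : lpAn E, AnalyticAt ℝ (fun z => F.1 (A z)) 0 := by
      intro F
      refine AnalyticAt.comp (g := F.1) (f := A) ?_ (A.analyticAt 0)
      rw [map_zero]; exact F.2
    obtain ⟨d, q, r, hq, hr, heq⟩ := lp_division (an (h ^ (N + 1))) (an g) (by
      intro hcon
      apply hw
      filter_upwards [hcon] with t ht
      have h1 : (h.1 (A (0, t))) ^ (N + 1) = 0 := ht
      have h2 := pow_eq_zero_iff (Nat.succ_ne_zero N) |>.mp h1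
      rw [hA] at h2
      simpa using h2)
    set P' := P - (l.comp P).smulRight w with hP'
    let B : E →L[ℝ] E × ℝ := P'.prod (l.comp P)
    have hAB : ∀ x, A (B x) = P x := by
      intro x
      change (P x - l (P x) • w) + l (P x) • w = P x
      abel
    have hqan : AnalyticAt ℝ (fun x => q (B x)) 0 := by
      refine AnalyticAt.comp (g := q) (f := B) ?_ (B.analyticAt 0)
      rw [map_zero]; exact hq
    let Q : lpAn E := ⟨fun x => q (B x), hqan⟩
    let R : lpAn E := ∑ j ∈ Finset.range d, lpPull P' ⟨r j, hr j⟩ * (lpLin (l.comp P)) ^ j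
    have hR : R ∈ lpKer hΔ :=
      sum_mem fun j _ => mul_mem (hpull _) (pow_mem (hlin _) _)
    have hR0 : Δ R = 0 := hR
    have hg : Δ (lpPull P g) = Δ (Q * (lpPull P h) ^ (N + 1) + R) := by
      apply hΔ.germ
      have hB : Tendsto B (𝓝 0) (𝓝 0) := by
        have := B.continuous.tendsto 0
        rwa [map_zero] at this
      filter_upwards [hB.eventually heq] with x hx
      rw [hAB] at hx
      have hRx : R.1 x = ∑ j ∈ Finset.range d, r j (P' x) * (l (P x)) ^ j := by
        change ((lpAn E).subtype R) x = _
        simp only [R, map_sum, map_mul, map_pow, Finset.sum_apply]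
        rfl
      change g.1 (P x) = q (B x) * (h.1 (P x)) ^ (N + 1) + R.1 x
      rw [hRx]
      exact hx
    rw [hg, hΔ.add, hR0, add_zero]
    exact hΔ.pow_bound hφ Q N
  have hlim := tendsto_pow_atTop_nhds_zero_of_lt_one (norm_nonneg _) hh
  exact norm_le_zero_iff.mp (ge_of_tendsto' hlim key)

theorem lp_line_zero {F : E → ℝ} (hF : AnalyticAt ℝ F 0)
    (h : ∀ v : E, ∀ᶠ t : ℝ in 𝓝 0, F (t • v) = 0) : ∀ᶠ x in 𝓝 (0 : E), F x = 0 := by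
  obtain ⟨s, hs, hball⟩ := Metric.eventually_nhds_iff_ball.mp hF.eventually_analyticAt
  refine Metric.eventually_nhds_iff_ball.mpr ⟨s, hs, fun x hx => ?_⟩
  have han : AnalyticOnNhd ℝ (fun t : ℝ => F (t • x)) (Set.Icc 0 1) := by
    intro t ht
    have h1 : AnalyticAt ℝ F (t • x) := by
      apply hball
      rw [mem_ball_zero_iff] at hx ⊢
      rw [norm_smul, Real.norm_of_nonneg ht.1]
      exact (mul_le_of_le_one_left (norm_nonneg x) ht.2).trans_lt hx
    exact AnalyticAt.comp (g := F) (f := fun t : ℝ => t • x) h1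
      (analyticAt_id.smul analyticAt_const)
  have h2 := han.eqOn_zero_of_preconnected_of_eventuallyEq_zero isPreconnected_Icc
    (Set.left_mem_Icc.mpr zero_le_one) (h x) (Set.right_mem_Icc.mpr zero_le_one)
  simpa using h2

theorem lp_exists_min [FiniteDimensional ℝ E] {φ : lpAn E →+* K} (hφ : ∀ F, ‖φ F‖ ≤ 1)
    (hgerm : ∀ F G : lpAn E, (∀ᶠ x in 𝓝 (0 : E), F.1 x = G.1 x) → φ F = φ G) :
    ∃ P : E →L[ℝ] E, LpRigid φ P ∧ ∀ h, ‖φ (lpPull P h)‖ < 1 → φ (lpPull P h) = 0 := by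
  have key : ∀ (m : ℕ) (P : E →L[ℝ] E), Module.finrank ℝ (LinearMap.range (P : E →ₗ[ℝ] E)) = m →
      LpRigid φ P →
      ∃ P : E →L[ℝ] E, LpRigid φ P ∧ ∀ h, ‖φ (lpPull P h)‖ < 1 → φ (lpPull P h) = 0 := by
    intro m
    induction m using Nat.strong_induction_on with
    | _ m ih =>
      intro P hPm hP
      by_cases hcon : ∀ h, ‖φ (lpPull P h)‖ < 1 → φ (lpPull P h) = 0
      · exact ⟨P, hP, hcon⟩
      push Not at hcon
      obtain ⟨h, hh1, hh0⟩ := hcon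
      have hv : ∃ v, ¬ ∀ᶠ t : ℝ in 𝓝 0, (lpPull P h).1 (t • v) = 0 := by
        by_contra hc
        push Not at hc
        apply hh0
        rw [← map_zero φ]
        exact hgerm _ _ (lp_line_zero (lpPull P h).2 hc)
      obtain ⟨v, hv⟩ := hv
      have hw : ¬ ∀ᶠ t : ℝ in 𝓝 0, h.1 (t • P v) = 0 := by
        intro hc; apply hv
        filter_upwards [hc] with t ht
        change h.1 (P (t • v)) = 0
        rw [map_smul]; exact ht
      have hw0 : P v ≠ 0 := by
        intro h0
        rw [h0] at hw
        simp only [smul_zero] at hw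
        have hc0 : h.1 0 ≠ 0 := by
          intro hc; apply hw; simp [hc]
        -- h does not vanish at 0, hence φ is a unit
        have hP0 : (lpPull P h).1 0 ≠ 0 := by
          change h.1 (P 0) ≠ 0
          rw [map_zero]; exact hc0
        let G : lpAn E := ⟨fun x => ((lpPull P h).1 x)⁻¹, AnalyticAt.inv (lpPull P h).2 hP0⟩
        have hG : φ (lpPull P h * G) = 1 := by
          rw [← map_one φ]
          apply hgerm
          have hne : ∀ᶠ x in 𝓝 (0 : E), (lpPull P h).1 x ≠ 0 :=
            (AnalyticAt.continuousAt (lpPull P h).2).eventually_ne hP0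
          filter_upwards [hne] with x hx
          exact mul_inv_cancel₀ hx
        have hn := congrArg norm hG
        rw [map_mul, norm_mul, norm_one] at hn
        have := hφ G
        have := norm_nonneg (φ G)
        have := norm_nonneg (φ (lpPull P h))
        nlinarith
      obtain ⟨l, hl⟩ := SeparatingDual.exists_eq_one (R := ℝ) hw0
      refine ih _ ?_ (P - (l.comp P).smulRight (P v)) rfl (lpRigid_step hφ hP h hh1 (P v) hw l)
      rw [← hPm]
      apply Submodule.finrank_lt_finrank_of_lt
      refine lt_of_le_of_ne ?_ ?_
      · rintro _ ⟨x, rfl⟩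
        exact ⟨x - l (P x) • v, by simp⟩
      · intro heq
        have hm : P v ∈ LinearMap.range ((P - (l.comp P).smulRight (P v) : E →L[ℝ] E) : E →ₗ[ℝ] E) := by
          rw [heq]; exact ⟨v, rfl⟩
        obtain ⟨x, hx⟩ := hm
        have hx' : P x - l (P x) • P v = P v := hx
        have := congrArg l hx'
        rw [map_sub, map_smul, hl, smul_eq_mul, mul_one, sub_self] at this
        exact zero_ne_one this
  exact key _ _ rfl (lpRigid_id φ)
end
end

section
section
variable {E : Type*} [NormedAddCommGroup E] [NormedSpace ℝ E] [FiniteDimensional ℝ E]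
variable {K : Type*} [NormedField K] [IsUltrametricDist K]

/-- coordinate functional of the standard finite basis -/
def lpX (E : Type*) [NormedAddCommGroup E] [NormedSpace ℝ E] [FiniteDimensional ℝ E]
    (i : Fin (Module.finrank ℝ E)) : E →L[ℝ] ℝ :=
  LinearMap.toContinuousLinearMap ((Module.finBasis ℝ E).coord i)

theorem lpX_sum (l : E →L[ℝ] ℝ) (x : E) :
    l x = ∑ i, l (Module.finBasis ℝ E i) * lpX E i x := by
  conv_lhs => rw [← (Module.finBasis ℝ E).sum_repr x]
  rw [map_sum]
  refine Finset.sum_congr rfl fun i _ => ?_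
  rw [map_smul, smul_eq_mul, mul_comm]
  rfl

theorem lpPar_add (v : E) (F G : lpAn E) {x : E} (hF : AnalyticAt ℝ F.1 x)
    (hG : AnalyticAt ℝ G.1 x) :
    (lpPar v (F + G)).1 x = (lpPar v F + lpPar v G).1 x := by
  change fderiv ℝ (F.1 + G.1) x v = fderiv ℝ F.1 x v + fderiv ℝ G.1 x v
  rw [fderiv_add hF.differentiableAt hG.differentiableAt]
  rfl

theorem lpPar_mul (v : E) (F G : lpAn E) {x : E} (hF : AnalyticAt ℝ F.1 x)
    (hG : AnalyticAt ℝ G.1 x) :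
    (lpPar v (F * G)).1 x = (F * lpPar v G + G * lpPar v F).1 x := by
  change fderiv ℝ (F.1 * G.1) x v = F.1 x * fderiv ℝ G.1 x v + G.1 x * fderiv ℝ F.1 x v
  rw [fderiv_mul hF.differentiableAt hG.differentiableAt]
  rfl

theorem lp_abstract {φ : lpAn E →+* K} (hφ : ∀ F, ‖φ F‖ ≤ 1)
    (hgerm : ∀ F G : lpAn E, (∀ᶠ x in 𝓝 (0 : E), F.1 x = G.1 x) → φ F = φ G)
    (hD : ∀ k0 : Subring K, (∀ z ∈ k0, z ≠ 0 → ‖z‖ = 1) → ∃ D : K → K,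
      (∀ x y, D (x + y) = D x + D y) ∧ (∀ x y, D (x * y) = x * D y + y * D x) ∧
      (∀ z ∈ k0, D z = 0) ∧ (∀ z, ‖z‖ ≤ 1 → ‖D z‖ < 1) ∧
      (∀ z, ‖z‖ = Real.exp (-1) → ‖D z‖ = Real.exp (-1)))
    (f : lpAn E) (hf : ‖φ f‖ = Real.exp (-1)) (hdf : ∀ v, ‖φ (lpPar v f)‖ ≤ Real.exp (-1)) :
    False := by
  obtain ⟨P, hP, hmin⟩ := lp_exists_min hφ hgerm
  obtain ⟨D, Dadd, Dmul, Dk, Dlt, Dexp⟩ := hD ((φ.comp (lpPull P)).range) (by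
    rintro _ ⟨h, rfl⟩ hne
    refine le_antisymm (hφ _) ?_
    by_contra hlt
    exact hne (hmin h (not_le.mp hlt)))
  have Dpull : ∀ g, D (φ (lpPull P g)) = 0 := fun g => Dk _ ⟨g, rfl⟩
  have Dcst : ∀ c, D (φ (lpCst E c)) = 0 := fun c => Dpull (lpCst E c)
  let b := Module.finBasis ℝ E
  let Δ : lpAn E → K := fun F => D (φ F) - ∑ i, φ (lpPar (b i) F) * D (φ (lpLin (lpX E i)))
  have D0 : D 0 = 0 := by
    have h1 := Dadd 0 0
    rw [add_zero] at h1
    exact left_eq_add.mp h1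
  have Dsum : ∀ {ι : Type} (s : Finset ι) (z : ι → K), D (∑ i ∈ s, z i) = ∑ i ∈ s, D (z i) :=
    fun s z => map_sum (AddMonoidHom.mk' D Dadd) z s
  have anE : ∀ F : lpAn E, ∀ᶠ x in 𝓝 (0 : E), AnalyticAt ℝ F.1 x :=
    fun F => AnalyticAt.eventually_analyticAt F.2
  have hΔ : LpDer φ Δ := by
    refine ⟨fun F G => ?_, fun F G => ?_, fun F => ?_, fun F G hFG => ?_⟩
    · have h1 : ∀ i, φ (lpPar (b i) (F + G)) = φ (lpPar (b i) F) + φ (lpPar (b i) G) := by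
        intro i
        rw [← map_add]
        apply hgerm
        filter_upwards [anE F, anE G] with x hx hy
        exact lpPar_add _ F G hx hy
      simp only [Δ, h1, add_mul, Finset.sum_add_distrib, map_add, Dadd]
      ring
    · have h1 : ∀ i, φ (lpPar (b i) (F * G)) =
          φ F * φ (lpPar (b i) G) + φ G * φ (lpPar (b i) F) := by
        intro i
        rw [← map_mul, ← map_mul, ← map_add]
        apply hgerm
        filter_upwards [anE F, anE G] with x hx hy
        exact lpPar_mul _ F G hx hy
      simp only [Δ, h1, add_mul, Finset.sum_add_distrib, map_mul, Dmul, mul_sub, Finset.mul_sum,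
        mul_assoc]
      ring
    · change ‖D (φ F) - ∑ i, φ (lpPar (b i) F) * D (φ (lpLin (lpX E i)))‖ ≤ 1
      rw [sub_eq_add_neg]
      refine (IsUltrametricDist.norm_add_le_max _ _).trans (max_le (Dlt _ (hφ F)).le ?_)
      rw [norm_neg]
      refine IsUltrametricDist.norm_sum_le_of_forall_le_of_nonneg zero_le_one fun i _ => ?_
      rw [norm_mul]
      exact mul_le_one₀ (hφ _) (norm_nonneg _) (Dlt _ (hφ _)).le
    · have h1 : ∀ i, φ (lpPar (b i) F) = φ (lpPar (b i) G) := by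
        intro i
        apply hgerm
        have h2 : F.1 =ᶠ[𝓝 0] G.1 := hFG
        filter_upwards [h2.fderiv (𝕜 := ℝ)] with x hx
        change fderiv ℝ F.1 x (b i) = fderiv ℝ G.1 x (b i)
        rw [hx]
      simp only [Δ, h1, hgerm F G hFG]
  have hDl : ∀ l, D (φ (lpLin l)) = ∑ i, φ (lpCst E (l (b i))) * D (φ (lpLin (lpX E i))) := by
    intro l
    have h1 : lpLin l = ∑ i, lpCst E (l (b i)) * lpLin (lpX E i) := by
      apply Subtype.ext
      funext x
      change l x = ((lpAn E).subtype (∑ i, lpCst E (l (b i)) * lpLin (lpX E i))) x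
      simp only [map_sum, map_mul, Finset.sum_apply]
      exact lpX_sum l x
    rw [h1, map_sum, Dsum]
    refine Finset.sum_congr rfl fun i _ => ?_
    rw [map_mul, Dmul, Dcst, mul_zero, add_zero]
  have hlin : ∀ l, Δ (lpLin l) = 0 := by
    intro l
    have h1 : ∀ i, lpPar (b i) (lpLin l) = lpCst E (l (b i)) := by
      intro i
      apply Subtype.ext
      funext x
      change fderiv ℝ l x (b i) = l (b i)
      rw [l.fderiv]
    simp only [Δ, h1, hDl l, sub_self]
  have hpull : ∀ g, Δ (lpPull P g) = 0 := by
    intro g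
    have hz : ∀ j, ∑ i, φ (lpCst E (lpX E j (P (b i)))) * D (φ (lpLin (lpX E i))) = 0 := by
      intro j
      exact (hDl ((lpX E j).comp P)).symm.trans (Dpull (lpLin (lpX E j)))
    have h1 : ∀ i, φ (lpPar (b i) (lpPull P g)) =
        ∑ j, φ (lpPull P (lpPar (b j) g)) * φ (lpCst E (lpX E j (P (b i)))) := by
      intro i
      simp only [← map_mul]
      rw [← map_sum]
      apply hgerm
      have hPt : Tendsto P (𝓝 0) (𝓝 0) := by
        have := P.continuous.tendsto 0
        rwa [map_zero] at this
      filter_upwards [hPt.eventually (anE g)] with x hx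
      have h2 : (lpPar (b i) (lpPull P g)).1 x = fderiv ℝ g.1 (P x) (P (b i)) := by
        change fderiv ℝ (g.1 ∘ P) x (b i) = _
        rw [fderiv_comp x hx.differentiableAt P.differentiableAt, P.fderiv]
        rfl
      rw [h2, lpX_sum (fderiv ℝ g.1 (P x)) (P (b i))]
      change _ = ((lpAn E).subtype (∑ j, lpPull P (lpPar (b j) g) *
        lpCst E (lpX E j (P (b i))))) x
      simp only [map_sum, map_mul, Finset.sum_apply]
      rfl
    change D (φ (lpPull P g)) - ∑ i, φ (lpPar (b i) (lpPull P g)) * D (φ (lpLin (lpX E i))) = 0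
    rw [Dpull, zero_sub, neg_eq_zero]
    simp only [h1, Finset.sum_mul]
    rw [Finset.sum_comm]
    refine Finset.sum_eq_zero fun j _ => ?_
    simp only [mul_assoc]
    rw [← Finset.mul_sum, hz, mul_zero]
  have h0 : Δ f = 0 := hP Δ hΔ hlin hpull f
  have h1 : D (φ f) = ∑ i, φ (lpPar (b i) f) * D (φ (lpLin (lpX E i))) := sub_eq_zero.mp h0
  have h2 := Dexp _ hf
  rw [h1] at h2
  have he := Real.exp_pos (-1)
  have h3 : ‖∑ i, φ (lpPar (b i) f) * D (φ (lpLin (lpX E i)))‖ < Real.exp (-1) := by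
    rcases (Finset.univ : Finset (Fin (Module.finrank ℝ E))).eq_empty_or_nonempty with hemp | hne
    · rw [hemp]; simpa using he
    · obtain ⟨i, _, hi⟩ := IsUltrametricDist.exists_norm_finsetSum_le_of_nonempty hne
        (fun i => φ (lpPar (b i) f) * D (φ (lpLin (lpX E i))))
      refine hi.trans_lt ?_
      rw [norm_mul]
      have h4 := hdf (b i)
      have h5 := Dlt _ (hφ (lpLin (lpX E i)))
      have := norm_nonneg (φ (lpPar (b i) f))
      have := norm_nonneg (D (φ (lpLin (lpX E i))))
      nlinarith
  exact h3.ne h2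
end
end

section
section
variable {E : Type*} [NormedAddCommGroup E] [NormedSpace ℝ E]
variable {ε : ℕ → ℝ} {hpos : ∀ k, 0 < ε k} {hlim : Tendsto ε atTop (𝓝 0)}

def lpSeq (p : ℕ → E) : lpAn E →+* (ℕ → ℂ) where
  toFun F := fun k => ((F.1 (p k) : ℝ) : ℂ)
  map_one' := by funext k; exact Complex.ofReal_one
  map_mul' F G := by funext k; exact Complex.ofReal_mul _ _
  map_zero' := by funext k; exact Complex.ofReal_zero
  map_add' F G := by funext k; exact Complex.ofReal_add _ _

theorem lpSeq_bdd {p : ℕ → E} (hp : Tendsto p atTop (𝓝 0)) (F : lpAn E) :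
    ∃ M : ℝ, 0 < M ∧ ∀ᶠ k in (lpU : Filter ℕ), ‖lpSeq p F k‖ ≤ M := by
  refine ⟨‖F.1 0‖ + 1, by positivity, ?_⟩
  have h1 : Tendsto (fun k => ‖F.1 (p k)‖) (lpU : Filter ℕ) (𝓝 ‖F.1 0‖) :=
    ((AnalyticAt.continuousAt F.2).tendsto.comp (hp.mono_left lpU_le)).norm
  filter_upwards [h1.eventually_lt_const (lt_add_one _)] with k hk
  change ‖((F.1 (p k) : ℝ) : ℂ)‖ ≤ _
  rw [Complex.norm_real]
  exact hk.le

theorem lpSeq_mod (hpos : ∀ k, 0 < ε k) (hlim : Tendsto ε atTop (𝓝 0)) {p : ℕ → E}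
    (hp : Tendsto p atTop (𝓝 0)) (F : lpAn E) : lpModerate ε (lpSeq p F) := by
  obtain ⟨M, hM, hb⟩ := lpSeq_bdd hp F
  refine lpModerate_of_le hpos ?_ (lp_const_mod hpos hlim (M : ℂ))
  filter_upwards [hb] with k hk
  rwa [Complex.norm_real, Real.norm_of_nonneg hM.le]

variable (ε hpos hlim) in
def lpPsi {p : ℕ → E} (hp : Tendsto p atTop (𝓝 0)) : lpAn E →+* lpMod ε hpos hlim :=
  (lpSeq p).codRestrict _ (fun F => lpSeq_mod hpos hlim hp F)

theorem lpPsi_apply {p : ℕ → E} (hp : Tendsto p atTop (𝓝 0)) (F : lpAn E) (k : ℕ) :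
    ‖(lpPsi ε hpos hlim hp F).1 k‖ = |F.1 (p k)| :=
  (Complex.norm_real _)

theorem lpPsi_tendsto {p : ℕ → E} (hp : Tendsto p atTop (𝓝 0)) (F : lpAn E) :
    Tendsto (fun k => |F.1 (p k)| ^ ε k) (lpU : Filter ℕ) (𝓝 (lpNu (lpPsi ε hpos hlim hp F))) := by
  have h := lpNu_tendsto (lpPsi ε hpos hlim hp F)
  have h2 : (fun k => ‖(lpPsi ε hpos hlim hp F).1 k‖ ^ ε k) = fun k => |F.1 (p k)| ^ ε k := by
    funext k; rw [lpPsi_apply]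
  rwa [h2] at h

theorem lp_contra [FiniteDimensional ℝ E] (hpos : ∀ k, 0 < ε k) (hlim : Tendsto ε atTop (𝓝 0))
    {p : ℕ → E} (hp : Tendsto p atTop (𝓝 0)) (f : lpAn E) (θ : ℕ → ℝ)
    (hθ : Tendsto θ atTop (𝓝 1))
    (h1 : ∀ k, |f.1 (p k)| ^ ε k = Real.exp (-1))
    (h2 : ∀ k, ‖fderiv ℝ f.1 (p k)‖ ≤ |f.1 (p k)| ^ θ k) : False := by
  refine lp_abstract (K := lpK ε hpos hlim)
    (φ := (lpPhi ε hpos hlim).comp (lpPsi ε hpos hlim hp)) ?_ ?_ lp_derivK f ?_ ?_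
  · intro F
    rw [RingHom.comp_apply, lp_norm_phi]
    obtain ⟨M, hM, hb⟩ := lpSeq_bdd hp F
    refine le_of_tendsto_of_tendsto (lpPsi_tendsto hp F) (lp_two_rpow hlim M hM) ?_
    filter_upwards [hb] with k hk
    refine Real.rpow_le_rpow (abs_nonneg _) ?_ (hpos k).le
    rw [← lpPsi_apply (hpos := hpos) (hlim := hlim) hp]
    exact hk
  · intro F G hFG
    rw [RingHom.comp_apply, RingHom.comp_apply, ← sub_eq_zero, ← map_sub, ← map_sub,
      lpPhi_eq_zero]
    refine tendsto_nhds_unique (lpPsi_tendsto hp (F - G)) ?_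
    refine tendsto_const_nhds.congr' ?_
    filter_upwards [(hp.mono_left lpU_le).eventually hFG] with k hk
    have h3 : (F - G).1 (p k) = 0 := sub_eq_zero.mpr hk
    rw [h3, abs_zero, Real.zero_rpow (hpos k).ne']
  · rw [RingHom.comp_apply, lp_norm_phi]
    refine tendsto_nhds_unique (lpPsi_tendsto hp f) ?_
    simp only [h1]
    exact tendsto_const_nhds
  · intro v
    rw [RingHom.comp_apply, lp_norm_phi]
    have h3 : Tendsto (fun k => Real.exp (-1) ^ θ k * (‖v‖ + 1) ^ ε k) (lpU : Filter ℕ)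
        (𝓝 (Real.exp (-1) ^ (1 : ℝ) * 1)) := by
      refine Tendsto.mul ?_ (lp_two_rpow hlim _ (by positivity))
      exact ((Real.continuous_const_rpow (Real.exp_pos _).ne').tendsto 1).comp
        (hθ.mono_left lpU_le)
    rw [Real.rpow_one, mul_one] at h3
    refine le_of_tendsto_of_tendsto' (lpPsi_tendsto hp (lpPar v f)) h3 ?_
    intro k
    have h4 : |(lpPar v f).1 (p k)| ≤ |f.1 (p k)| ^ θ k * (‖v‖ + 1) := by
      change ‖fderiv ℝ f.1 (p k) v‖ ≤ _
      refine ((fderiv ℝ f.1 (p k)).le_opNorm v).trans ?_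
      have h5 := h2 k
      have h6 : 0 ≤ |f.1 (p k)| ^ θ k := by positivity
      exact mul_le_mul h5 (by linarith) (norm_nonneg _) h6
    refine (Real.rpow_le_rpow (abs_nonneg _) h4 (hpos k).le).trans_eq ?_
    rw [Real.mul_rpow (by positivity) (by positivity), ← Real.rpow_mul (abs_nonneg _), mul_comm (θ k),
      Real.rpow_mul (abs_nonneg _), h1]

/-- The real Lojasiewicz gradient inequality. -/
theorem lp_loj [FiniteDimensional ℝ E] {f : E → ℝ} (hf : AnalyticAt ℝ f 0) (h0 : f 0 = 0) :
    ∃ θ ∈ Set.Ioo (0 : ℝ) 1, ∀ᶠ x in 𝓝 (0 : E), |f x| ^ θ ≤ ‖fderiv ℝ f x‖ := by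
  by_contra hcon
  push Not at hcon
  let θ : ℕ → ℝ := fun k => 1 - 1 / ((k : ℝ) + 2)
  have hθm : ∀ k, θ k ∈ Set.Ioo (0 : ℝ) 1 := by
    intro k
    have hk : (0 : ℝ) ≤ k := Nat.cast_nonneg k
    have h1 : 1 / ((k : ℝ) + 2) < 1 := by rw [div_lt_one (by linarith)]; linarith
    have h2 : 0 < 1 / ((k : ℝ) + 2) := by positivity
    exact ⟨by simp only [θ]; linarith, by simp only [θ]; linarith⟩
  have hex : ∀ k : ℕ, ∃ x : E, ‖x‖ < 1 / ((k : ℝ) + 1) ∧ |f x| < Real.exp (-((k : ℝ) + 1)) ∧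
      ‖fderiv ℝ f x‖ < |f x| ^ θ k := by
    intro k
    have e1 : ∀ᶠ x in 𝓝 (0 : E), ‖x‖ < 1 / ((k : ℝ) + 1) := by
      have : Tendsto (fun x : E => ‖x‖) (𝓝 0) (𝓝 0) := by simpa using (continuous_norm.tendsto (0 : E))
      exact this.eventually_lt_const (by positivity)
    have e2 : ∀ᶠ x in 𝓝 (0 : E), |f x| < Real.exp (-((k : ℝ) + 1)) := by
      have h1 : Tendsto (fun x : E => |f x|) (𝓝 0) (𝓝 |f 0|) := hf.continuousAt.tendsto.abs
      rw [h0, abs_zero] at h1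
      exact h1.eventually_lt_const (Real.exp_pos _)
    obtain ⟨x, hx, hx1, hx2⟩ := ((hcon (θ k) (hθm k)).and_eventually (e1.and e2)).exists
    exact ⟨x, hx1, hx2, hx⟩
  choose p hp1 hp2 hp3 using hex
  have hτ : ∀ k, 0 < |f (p k)| := by
    intro k
    refine (abs_nonneg _).lt_of_ne fun h => ?_
    have h1 := hp3 k
    rw [← h, Real.zero_rpow (hθm k).1.ne'] at h1
    exact absurd h1 (not_lt.mpr (norm_nonneg _))
  have hN : ∀ k : ℕ, (k : ℝ) + 1 < -Real.log |f (p k)| := by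
    intro k
    have h1 := Real.log_lt_log (hτ k) (hp2 k)
    rw [Real.log_exp] at h1
    linarith
  have hk1 : ∀ k : ℕ, (0 : ℝ) < (k : ℝ) + 1 := fun k => by positivity
  have hlim1 : Tendsto (fun k : ℕ => 1 / ((k : ℝ) + 1)) atTop (𝓝 0) :=
    tendsto_one_div_add_atTop_nhds_zero_nat
  refine lp_contra (ε := fun k => 1 / (-Real.log |f (p k)|)) (p := p) ?_ ?_ ?_ ⟨f, hf⟩ θ ?_ ?_ ?_
  · intro k
    exact one_div_pos.mpr ((hk1 k).trans (hN k))
  · refine squeeze_zero (fun k => (one_div_pos.mpr ((hk1 k).trans (hN k))).le) (fun k => ?_) hlim1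
    exact one_div_le_one_div_of_le (hk1 k) (hN k).le
  · rw [tendsto_zero_iff_norm_tendsto_zero]
    exact squeeze_zero (fun k => norm_nonneg _) (fun k => (hp1 k).le) hlim1
  · have h1 : Tendsto (fun k : ℕ => 1 / ((k : ℝ) + 2)) atTop (𝓝 0) := by
      refine squeeze_zero (fun k => by positivity) (fun k => ?_) hlim1
      exact one_div_le_one_div_of_le (hk1 k) (by linarith)
    have h2 := h1.const_sub 1
    rwa [sub_zero] at h2
  · intro k
    have h1 := (hk1 k).trans (hN k)
    change |f (p k)| ^ (1 / (-Real.log |f (p k)|)) = Real.exp (-1)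
    rw [Real.rpow_def_of_pos (hτ k)]
    congr 1
    have h2 : Real.log |f (p k)| ≠ 0 := by linarith
    field_simp
  · intro k
    exact (hp3 k).le
end
end

section

theorem pp_rel {a₁ a₂ a₃ b₁ b₂ b₃ : ℝ} (hp : IsPerplexParam a₁ a₂ a₃ b₁ b₂ b₃) :
    a₁ * b₂ - a₂ * b₁ - b₂ ^ 2 + b₁ * b₃ = 0 := by
  obtain ⟨h1, h2, h3, h4⟩ := hp
  by_contra hr
  have e2 : a₂ * (a₁ * b₂ - a₂ * b₁ - b₂ ^ 2 + b₁ * b₃) = 0 := by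
    linear_combination b₁ * h4 + (a₁ - b₂) * h3
  have e3 : a₃ * (a₁ * b₂ - a₂ * b₁ - b₂ ^ 2 + b₁ * b₃) = 0 := by
    linear_combination b₂ * h4 + (a₂ - b₃) * h3
  have f2 : a₂ = 0 := (mul_eq_zero.mp e2).resolve_right hr
  have f3 : a₃ = 0 := (mul_eq_zero.mp e3).resolve_right hr
  apply h1
  rw [f2, f3]; ring

theorem pp_assoc {a₁ a₂ a₃ b₁ b₂ b₃ : ℝ} (hp : IsPerplexParam a₁ a₂ a₃ b₁ b₂ b₃) (x y z : ℝ × ℝ) :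
    pmul a₁ a₂ a₃ b₁ b₂ b₃ (pmul a₁ a₂ a₃ b₁ b₂ b₃ x y) z =
      pmul a₁ a₂ a₃ b₁ b₂ b₃ x (pmul a₁ a₂ a₃ b₁ b₂ b₃ y z) := by
  have hr := pp_rel hp
  obtain ⟨h1, h2, h3, h4⟩ := hp
  apply Prod.ext
  · simp only [pmul]
    linear_combination (x.1 * z.2 - x.2 * z.1) * (-y.1 * h3 - y.2 * h4)
  · simp only [pmul]
    linear_combination (x.1 * z.2 - x.2 * z.1) * (y.1 * hr + y.2 * h3)

theorem pp_comm (a₁ a₂ a₃ b₁ b₂ b₃ : ℝ) (x y : ℝ × ℝ) :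
    pmul a₁ a₂ a₃ b₁ b₂ b₃ x y = pmul a₁ a₂ a₃ b₁ b₂ b₃ y x := by
  apply Prod.ext
  · simp only [pmul]; ring
  · simp only [pmul]; ring

theorem pp_one {a₁ a₂ a₃ b₁ b₂ b₃ : ℝ} (hp : IsPerplexParam a₁ a₂ a₃ b₁ b₂ b₃) (z : ℝ × ℝ) :
    pmul a₁ a₂ a₃ b₁ b₂ b₃ (pone a₁ a₂ b₁ b₂) z = z := by
  have hr := pp_rel hp
  obtain ⟨h1, h2, h3, h4⟩ := hp
  have hi : (a₁ * b₂ - a₂ * b₁) * (1 / (a₁ * b₂ - a₂ * b₁)) = 1 := mul_one_div_cancel h2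
  unfold pone
  generalize 1 / (a₁ * b₂ - a₂ * b₁) = i at hi
  apply Prod.ext
  · simp only [pmul, Prod.smul_mk, smul_eq_mul]
    linear_combination z.1 * hi + i * z.2 * h3
  · simp only [pmul, Prod.smul_mk, smul_eq_mul]
    linear_combination z.2 * hi - i * z.2 * hr

theorem pp_inv {a₁ a₂ a₃ b₁ b₂ b₃ : ℝ} (hp : IsPerplexParam a₁ a₂ a₃ b₁ b₂ b₃) :
    pmul a₁ a₂ a₃ b₁ b₂ b₃ (1, 0) (pinv a₁ a₂ a₃ b₁ b₂ b₃ (1, 0)) = pone a₁ a₂ b₁ b₂ := by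
  have hex : ∃ y, pmul a₁ a₂ a₃ b₁ b₂ b₃ (1, 0) y = pone a₁ a₂ b₁ b₂ := by
    obtain ⟨h1, h2, h3, h4⟩ := hp
    have hi : (a₁ * b₂ - a₂ * b₁) * (1 / (a₁ * b₂ - a₂ * b₁)) = 1 := mul_one_div_cancel h2
    unfold pone
    generalize 1 / (a₁ * b₂ - a₂ * b₁) = i at hi
    refine ⟨((b₂ ^ 2 + a₂ * b₁) * i ^ 2, (-b₁ * b₂ - a₁ * b₁) * i ^ 2), ?_⟩
    apply Prod.ext
    · simp only [pmul, Prod.smul_mk, smul_eq_mul]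
      linear_combination b₂ * i * hi
    · simp only [pmul, Prod.smul_mk, smul_eq_mul]
      linear_combination -b₁ * i * hi
  unfold pinv
  rw [dif_pos hex]
  exact hex.choose_spec

theorem pp_bound (a₁ a₂ a₃ b₁ b₂ b₃ : ℝ) : ∃ A > (0 : ℝ), ∀ x y : ℝ × ℝ, ‖x‖ ≤ 1 →
    ‖pmul a₁ a₂ a₃ b₁ b₂ b₃ x y‖ ≤ A * ‖y‖ := by
  have key : ∀ c₁ c₂ c₃ : ℝ, ∀ x y : ℝ × ℝ, ‖x‖ ≤ 1 →
      |c₁ * x.1 * y.1 + c₂ * (x.1 * y.2 + x.2 * y.1) + c₃ * x.2 * y.2| ≤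
        (|c₁| + 2 * |c₂| + |c₃|) * ‖y‖ := by
    intro c₁ c₂ c₃ x y hx
    have x1 : |x.1| ≤ 1 := (norm_fst_le x).trans hx
    have x2 : |x.2| ≤ 1 := (norm_snd_le x).trans hx
    have y1 : |y.1| ≤ ‖y‖ := norm_fst_le y
    have y2 : |y.2| ≤ ‖y‖ := norm_snd_le y
    have t : ∀ c r s : ℝ, |r| ≤ 1 → |s| ≤ ‖y‖ → |c * r * s| ≤ |c| * ‖y‖ := by
      intro c r s hr hs
      rw [abs_mul, abs_mul]
      calc |c| * |r| * |s| ≤ |c| * 1 * ‖y‖ := by gcongr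
        _ = _ := by ring
    have t1 := t c₁ _ _ x1 y1
    have t2 := t c₂ _ _ x1 y2
    have t3 := t c₂ _ _ x2 y1
    have t4 := t c₃ _ _ x2 y2
    have e : c₁ * x.1 * y.1 + c₂ * (x.1 * y.2 + x.2 * y.1) + c₃ * x.2 * y.2 =
      c₁ * x.1 * y.1 + c₂ * x.1 * y.2 + c₂ * x.2 * y.1 + c₃ * x.2 * y.2 := by ring
    rw [e]
    have u1 := abs_add_le (c₁ * x.1 * y.1 + c₂ * x.1 * y.2 + c₂ * x.2 * y.1) (c₃ * x.2 * y.2)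
    have u2 := abs_add_le (c₁ * x.1 * y.1 + c₂ * x.1 * y.2) (c₂ * x.2 * y.1)
    have u3 := abs_add_le (c₁ * x.1 * y.1) (c₂ * x.1 * y.2)
    linarith
  refine ⟨(|a₁| + 2 * |a₂| + |a₃|) + (|b₁| + 2 * |b₂| + |b₃|) + 1, by positivity, ?_⟩
  intro x y hx
  have k1 := key a₁ a₂ a₃ x y hx
  have k2 := key b₁ b₂ b₃ x y hx
  have hy := norm_nonneg y
  rw [Prod.norm_def]
  refine max_le ?_ ?_
  · refine k1.trans (mul_le_mul_of_nonneg_right ?_ hy)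
    have : 0 ≤ |b₁| + 2 * |b₂| + |b₃| := by positivity
    linarith
  · refine k2.trans (mul_le_mul_of_nonneg_right ?_ hy)
    have : 0 ≤ |a₁| + 2 * |a₂| + |a₃| := by positivity
    linarith

theorem pp_clm_bound {n : ℕ} (T : (Fin n → ℝ × ℝ) →L[ℝ] ℝ × ℝ) {B : ℝ} (hB : 0 ≤ B)
    (h1 : ∀ i, ‖T (Pi.single i (1, 0))‖ ≤ B) (h2 : ∀ i, ‖T (Pi.single i (0, 1))‖ ≤ B) :
    ‖T‖ ≤ 2 * n * B := by
  refine T.opNorm_le_bound (by positivity) fun x => ?_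
  have hx : x = ∑ i, ((x i).1 • (Pi.single i ((1, 0) : ℝ × ℝ) : Fin n → ℝ × ℝ) +
      (x i).2 • (Pi.single i ((0, 1) : ℝ × ℝ) : Fin n → ℝ × ℝ)) := by
    conv_lhs => rw [← Finset.univ_sum_single x]
    refine Finset.sum_congr rfl fun i _ => ?_
    rw [← Pi.single_smul, ← Pi.single_smul, ← Pi.single_add]
    congr 1
    apply Prod.ext <;> simp
  have hT : ‖T x‖ ≤ ∑ _i : Fin n, 2 * B * ‖x‖ := by
    conv_lhs => rw [hx]
    rw [map_sum]
    refine (norm_sum_le _ _).trans (Finset.sum_le_sum fun i _ => ?_)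
    rw [map_add, map_smul, map_smul]
    refine (norm_add_le _ _).trans ?_
    rw [norm_smul, norm_smul]
    have c1 : ‖(x i).1‖ ≤ ‖x‖ := (norm_fst_le _).trans (norm_le_pi_norm x i)
    have c2 : ‖(x i).2‖ ≤ ‖x‖ := (norm_snd_le _).trans (norm_le_pi_norm x i)
    have d1 := mul_le_mul c1 (h1 i) (norm_nonneg _) (norm_nonneg _)
    have d2 := mul_le_mul c2 (h2 i) (norm_nonneg _) (norm_nonneg _)
    linarith
  refine hT.trans_eq ?_
  rw [Finset.sum_const, Finset.card_univ, Fintype.card_fin, nsmul_eq_mul]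
  ring

theorem pp_mnorm (x : ℝ × ℝ) : mnorm x = ‖x‖ := rfl
end

/-- Theorem 4.2 (Łojasiewicz inequality): for a `ℙ_{a,b}`-analytic function
`f : ℙ_{a,b}ⁿ → ℙ_{a,b}` with `f(0) = 0`, there are a neighborhood `U` of `0`,
`C > 0` and `θ ∈ (0,1)` with `maxᵢ ‖∂f/∂pᵢ(p)‖ₘ ≥ C‖f(p)‖ₘ^θ` on `U`. -/
theorem lojasiewicz_perplex (a₁ a₂ a₃ b₁ b₂ b₃ : ℝ)
    (hp : IsPerplexParam a₁ a₂ a₃ b₁ b₂ b₃)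
    (n : ℕ) (hn : 0 < n)
    (f : (Fin n → ℝ × ℝ) → ℝ × ℝ)
    (han : AnalyticOnNhd ℝ f Set.univ)
    (hf0 : f 0 = 0)
    (hGCR : ∀ p : Fin n → ℝ × ℝ, ∀ i : Fin n,
      pmul a₁ a₂ a₃ b₁ b₂ b₃ ((0, 1) : ℝ × ℝ) (fderiv ℝ f p (Pi.single i ((1, 0) : ℝ × ℝ))) =
        pmul a₁ a₂ a₃ b₁ b₂ b₃ ((1, 0) : ℝ × ℝ) (fderiv ℝ f p (Pi.single i ((0, 1) : ℝ × ℝ)))) :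
    ∃ U ∈ nhds (0 : Fin n → ℝ × ℝ), ∃ C > (0 : ℝ), ∃ θ ∈ Set.Ioo (0 : ℝ) 1,
      ∀ p ∈ U,
        C * mnorm (f p) ^ θ ≤
          Finset.univ.sup' ⟨(⟨0, hn⟩ : Fin n), Finset.mem_univ _⟩
            (fun i =>
              mnorm (pmul a₁ a₂ a₃ b₁ b₂ b₃ (pinv a₁ a₂ a₃ b₁ b₂ b₃ ((1, 0) : ℝ × ℝ))
                (fderiv ℝ f p (Pi.single i ((1, 0) : ℝ × ℝ))))) := by
  obtain ⟨A, hA, hAb⟩ := pp_bound a₁ a₂ a₃ b₁ b₂ b₃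
  have hu : AnalyticAt ℝ (fun x => (f x).1) 0 :=
    AnalyticAt.comp (g := Prod.fst) analyticAt_fst (han 0 (Set.mem_univ _))
  have hv : AnalyticAt ℝ (fun x => (f x).2) 0 :=
    AnalyticAt.comp (g := Prod.snd) analyticAt_snd (han 0 (Set.mem_univ _))
  obtain ⟨θ₁, hθ₁, hL₁⟩ := lp_loj hu (by simp [hf0])
  obtain ⟨θ₂, hθ₂, hL₂⟩ := lp_loj hv (by simp [hf0])
  have small : ∀ᶠ x in nhds (0 : Fin n → ℝ × ℝ), ‖f x‖ < 1 := by
    have h1 : Tendsto (fun x => ‖f x‖) (𝓝 0) (𝓝 ‖f 0‖) :=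
      (han 0 (Set.mem_univ _)).continuousAt.tendsto.norm
    rw [hf0, norm_zero] at h1
    exact h1.eventually_lt_const one_pos
  have hn' : (0 : ℝ) < n := by exact_mod_cast hn
  refine ⟨_, (hL₁.and (hL₂.and small)), (2 * n * A)⁻¹, by positivity, max θ₁ θ₂,
    ⟨lt_max_of_lt_left hθ₁.1, max_lt hθ₁.2 hθ₂.2⟩, ?_⟩
  rintro p ⟨hp1, hp2, hp3⟩
  set S := Finset.univ.sup' ⟨(⟨0, hn⟩ : Fin n), Finset.mem_univ _⟩
    (fun i => mnorm (pmul a₁ a₂ a₃ b₁ b₂ b₃ (pinv a₁ a₂ a₃ b₁ b₂ b₃ ((1, 0) : ℝ × ℝ))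
      (fderiv ℝ f p (Pi.single i ((1, 0) : ℝ × ℝ))))) with hSdef
  have hle : ∀ i, ‖pmul a₁ a₂ a₃ b₁ b₂ b₃ (pinv a₁ a₂ a₃ b₁ b₂ b₃ ((1, 0) : ℝ × ℝ))
      (fderiv ℝ f p (Pi.single i ((1, 0) : ℝ × ℝ)))‖ ≤ S := fun i =>
    Finset.le_sup' (fun i => mnorm (pmul a₁ a₂ a₃ b₁ b₂ b₃
      (pinv a₁ a₂ a₃ b₁ b₂ b₃ ((1, 0) : ℝ × ℝ))
      (fderiv ℝ f p (Pi.single i ((1, 0) : ℝ × ℝ))))) (Finset.mem_univ i)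
  have hS0 : 0 ≤ S := (norm_nonneg _).trans (hle ⟨0, hn⟩)
  have hdf : DifferentiableAt ℝ f p := (han p (Set.mem_univ _)).differentiableAt
  have hbound : ‖fderiv ℝ f p‖ ≤ 2 * n * (A * S) := by
    refine pp_clm_bound _ (by positivity) (fun i => ?_) (fun i => ?_)
    · have h1 : fderiv ℝ f p (Pi.single i ((1, 0) : ℝ × ℝ)) =
          pmul a₁ a₂ a₃ b₁ b₂ b₃ (1, 0) (pmul a₁ a₂ a₃ b₁ b₂ b₃ (pinv a₁ a₂ a₃ b₁ b₂ b₃ (1, 0))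
            (fderiv ℝ f p (Pi.single i ((1, 0) : ℝ × ℝ)))) := by
        rw [← pp_assoc hp, pp_inv hp, pp_one hp]
      rw [h1]
      refine (hAb _ _ (by simp [Prod.norm_def])).trans ?_
      exact mul_le_mul_of_nonneg_left (hle i) hA.le
    · have h1 : fderiv ℝ f p (Pi.single i ((0, 1) : ℝ × ℝ)) =
          pmul a₁ a₂ a₃ b₁ b₂ b₃ (0, 1) (pmul a₁ a₂ a₃ b₁ b₂ b₃ (pinv a₁ a₂ a₃ b₁ b₂ b₃ (1, 0))
            (fderiv ℝ f p (Pi.single i ((1, 0) : ℝ × ℝ)))) := by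
        rw [← pp_assoc hp, pp_comm a₁ a₂ a₃ b₁ b₂ b₃ (0, 1), pp_assoc hp, hGCR p i, ← pp_assoc hp,
          pp_comm a₁ a₂ a₃ b₁ b₂ b₃ _ (1, 0), pp_inv hp, pp_one hp]
      rw [h1]
      refine (hAb _ _ (by simp [Prod.norm_def])).trans ?_
      exact mul_le_mul_of_nonneg_left (hle i) hA.le
  have hfst : ‖fderiv ℝ (fun x => (f x).1) p‖ ≤ ‖fderiv ℝ f p‖ := by
    refine ContinuousLinearMap.opNorm_le_bound _ (norm_nonneg _) fun x => ?_
    rw [hdf.hasFDerivAt.fst.fderiv]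
    exact (norm_fst_le _).trans ((fderiv ℝ f p).le_opNorm x)
  have hsnd : ‖fderiv ℝ (fun x => (f x).2) p‖ ≤ ‖fderiv ℝ f p‖ := by
    refine ContinuousLinearMap.opNorm_le_bound _ (norm_nonneg _) fun x => ?_
    rw [hdf.hasFDerivAt.snd.fderiv]
    exact (norm_snd_le _).trans ((fderiv ℝ f p).le_opNorm x)
  have hpow : ∀ (s t : ℝ), 0 < t → t ≤ max θ₁ θ₂ → |s| ≤ 1 → |s| ^ max θ₁ θ₂ ≤ |s| ^ t :=
    fun s t ht hle hs => Real.rpow_le_rpow_of_exponent_ge' (abs_nonneg s) hs ht.le hle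
  have hmain : mnorm (f p) ^ max θ₁ θ₂ ≤ ‖fderiv ℝ f p‖ := by
    rw [mnorm, Real.rpow_max (abs_nonneg _) (abs_nonneg _) (le_max_of_le_left hθ₁.1.le)]
    refine max_le ?_ ?_
    · exact (hpow _ θ₁ hθ₁.1 (le_max_left _ _) ((norm_fst_le (f p)).trans hp3.le)).trans
        (hp1.trans hfst)
    · exact (hpow _ θ₂ hθ₂.1 (le_max_right _ _) ((norm_snd_le (f p)).trans hp3.le)).trans
        (hp2.trans hsnd)
  rw [inv_mul_le_iff₀ (by positivity)]
  refine (hmain.trans hbound).trans_eq ?_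
  ring
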